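/- arXiv:2011.03126 — 3 statements merged into one kernel-verified Lean document; each statement's English description precedes it below -/
import Mathlib

section
/- Fix k ∈ ℕ, r > 0, and f, g ∈ C^k(ℝ). Then ‖(fg)^{[k]}‖_{r,k+1} ≤ Σ_{j=0}^k ‖f^{[j]}‖_{r,j+1} · ‖g^{[k−j]}‖_{r,k−j+1} and ‖fg‖_{𝒞^{[k]},r} ≤ ‖f‖_{𝒞^{[k]},r} · ‖g‖_{𝒞^{[k]},r} (inequalities in [0,∞], with the convention 0·∞ := 0). -/
open MeasureTheory Filter
open scoped ENNReal NNReal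

/-- The continuous extension of the `k`-th divided difference of a `C^k` function, given by
integration of the `k`-th derivative over the standard simplex (Proposition 2.3(ii)). -/
noncomputable def divDiffC (f : ℝ → ℂ) (k : ℕ) (lam : Fin (k + 1) → ℝ) : ℂ :=
  ∫ s in {s : Fin k → ℝ | (∀ i, 0 ≤ s i) ∧ ∑ i, s i ≤ 1},
    iteratedDeriv k f
      ((∑ i : Fin k, s i * lam i.castSucc) + (1 - ∑ i : Fin k, s i) * lam (Fin.last k))

/-- The `ℓ^∞`-integral projective tensor norm of a function `φ : Ω_1 × ⋯ × Ω_m → ℂ`: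
the infimum, over all `ℓ^∞`-integral projective decompositions
`(Σ, ρ, φ_1, …, φ_m)` of `φ` (with `ρ` a σ-finite measure, the `φ_j` product-measurable and
bounded in the first variable, and `φ(ω) = ∫_Σ ∏_j φ_j(ω_j, σ) ρ(dσ)`), of
`∫_Σ ∏_j sup_{ω_j} |φ_j(ω_j, σ)| ρ(dσ)`; it is `∞` if no decomposition exists. -/
noncomputable def iptNorm {m : ℕ} {Ω : Fin m → Type*} [∀ i, MeasurableSpace (Ω i)]
    (φ : (∀ i, Ω i) → ℂ) : ℝ≥0∞ :=
  sInf {c : ℝ≥0∞ |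
    ∃ (S : Type) (_ : MeasurableSpace S) (ρ : MeasureTheory.Measure S)
      (φs : ∀ i, Ω i × S → ℂ),
      MeasureTheory.SigmaFinite ρ ∧ (∀ i, Measurable (φs i)) ∧
      (∀ i σ, ∃ C : ℝ, ∀ ω, ‖φs i (ω, σ)‖ ≤ C) ∧
      (∫⁻ σ, ∏ i, ⨆ ω, (‖φs i (ω, σ)‖₊ : ℝ≥0∞) ∂ρ) ≠ ∞ ∧
      (∀ ω : ∀ i, Ω i, φ ω = ∫ σ, ∏ i, φs i (ω i, σ) ∂ρ) ∧
      c = ∫⁻ σ, ∏ i, ⨆ ω, (‖φs i (ω, σ)‖₊ : ℝ≥0∞) ∂ρ}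

/-- `‖φ‖_{r,m}` : the `ℓ^∞`-integral projective tensor norm of `φ` restricted to `[-r,r]^m`. -/
noncomputable def iptNormIcc (r : ℝ) {m : ℕ} (φ : (Fin m → ℝ) → ℂ) : ℝ≥0∞ :=
  iptNorm (Ω := fun _ : Fin m => (Set.Icc (-r) r : Set ℝ)) fun ω => φ fun i => (ω i : ℝ)



lemma aux_inner {Y : Type*} [TopologicalSpace Y] [T2Space Y] [MeasurableSpace Y] [BorelSpace Y]
    (μ : Measure Y) [IsFiniteMeasure μ] (f : (ℕ → ℕ) → Y) (hf : Continuous f) (c : ℝ≥0∞)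
    (hc : c < μ (Set.range f)) : ∃ K, MeasurableSet K ∧ K ⊆ Set.range f ∧ c ≤ μ K := by
  have step : ∀ (U : Set (ℕ → ℕ)) (n : ℕ), ∃ m : ℕ, c < μ (f '' U) →
      c < μ (f '' (U ∩ {x | x n ≤ m})) := by
    intro U n
    by_cases h : c < μ (f '' U)
    · have h1 : f '' U = ⋃ m : ℕ, f '' (U ∩ {x | x n ≤ m}) := by
        rw [← Set.image_iUnion, ← Set.inter_iUnion]
        congr 1
        ext x
        simp only [Set.mem_inter_iff, Set.mem_iUnion, Set.mem_ofPred_eq]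
        exact ⟨fun h => ⟨h, _, le_rfl⟩, fun h => h.1⟩
      have hd : Monotone (fun m : ℕ => f '' (U ∩ {x | x n ≤ m})) := by
        intro a b hab
        apply Set.image_mono
        intro x hx
        exact ⟨hx.1, le_trans hx.2 hab⟩
      have h2 := h
      rw [h1, hd.measure_iUnion, lt_iSup_iff] at h2
      obtain ⟨m, hm⟩ := h2
      exact ⟨m, fun _ => hm⟩
    · exact ⟨0, fun h' => absurd h' h⟩
  choose m hm using step
  let U : ℕ → Set (ℕ → ℕ) := fun n => Nat.rec Set.univ (fun n V => V ∩ {x | x n ≤ m V n}) n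
  have hU0 : U 0 = Set.univ := rfl
  have hUs : ∀ n, U (n+1) = U n ∩ {x | x n ≤ m (U n) n} := fun n => rfl
  have hUc : ∀ n, c < μ (f '' U n) := by
    intro n
    induction n with
    | zero => rw [hU0, Set.image_univ]; exact hc
    | succ n ih => rw [hUs]; exact hm _ _ ih
  let b : ℕ → ℕ := fun n => m (U n) n
  have hUb : ∀ n, U n = {x | ∀ i < n, x i ≤ b i} := by
    intro n
    induction n with
    | zero => simp [hU0]
    | succ n ih =>
      rw [hUs]
      ext x
      constructor
      · rintro ⟨h1, h2⟩ i hi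
        rw [ih] at h1
        rcases Nat.lt_succ_iff_lt_or_eq.1 hi with h | h
        · exact h1 i h
        · subst h; exact h2
      · intro h
        refine ⟨?_, h n (Nat.lt_succ_self n)⟩
        rw [ih]
        exact fun i hi => h i (Nat.lt_succ_of_lt hi)
  let K : Set (ℕ → ℕ) := Set.pi Set.univ (fun i => Set.Iic (b i))
  have hK : IsCompact K := isCompact_univ_pi (fun i => (Set.finite_Iic (b i)).isCompact)
  have hfK : IsCompact (f '' K) := hK.image hf
  refine ⟨f '' K, hfK.measurableSet, Set.image_subset_range _ _, ?_⟩
  have hanti : Antitone (fun n => closure (f '' U n)) := by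
    apply antitone_nat_of_succ_le
    intro n
    exact closure_mono (Set.image_mono (by rw [hUs]; exact Set.inter_subset_left))
  have hsub : (⋂ n, closure (f '' U n)) ⊆ f '' K := by
    intro y hy
    by_contra hyK
    obtain ⟨V, W, hV, hW, hKV, hyW, hVW⟩ :=
      hfK.separation_of_notMem hyK
    have hn : ∃ n, U n ⊆ f ⁻¹' V := by
      by_contra! hcon
      have : ∀ n, ∃ x ∈ U n, f x ∉ V := by
        intro n
        obtain ⟨x, hx, hx'⟩ := Set.not_subset.1 (hcon n)
        exact ⟨x, hx, hx'⟩
      choose x hxU hxV using this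
      have hx' : ∀ n, (fun i => min (x n i) (b i)) ∈ K := fun n i _ => Set.mem_Iic.2 (min_le_right _ _)
      obtain ⟨z, hz, φ, hφ, hlim⟩ := hK.tendsto_subseq hx'
      have hlim2 : Tendsto (fun n => x (φ n)) atTop (nhds z) := by
        rw [tendsto_pi_nhds] at hlim ⊢
        intro i
        refine (hlim i).congr' ?_
        filter_upwards [eventually_gt_atTop i] with n hn
        have : x (φ n) i ≤ b i := by
          have h := hxU (φ n)
          rw [hUb] at h
          exact h i (lt_of_lt_of_le hn (hφ.id_le n))
        simp [this]
      have h3 : Tendsto (fun n => f (x (φ n))) atTop (nhds (f z)) :=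
        (hf.tendsto z).comp hlim2
      have h4 := h3.eventually (hV.mem_nhds (hKV ⟨z, hz, rfl⟩))
      obtain ⟨n, hn⟩ := h4.exists
      exact hxV _ hn
    obtain ⟨n, hn⟩ := hn
    have h5 := Set.mem_iInter.1 hy n
    rw [mem_closure_iff] at h5
    obtain ⟨w, hwW, u, hu, rfl⟩ := h5 W hW hyW
    exact Set.disjoint_left.1 hVW (hn hu) hwW
  calc c ≤ ⨅ n, μ (closure (f '' U n)) :=
        le_iInf fun n => (hUc n).le.trans (measure_mono subset_closure)
    _ = μ (⋂ n, closure (f '' U n)) :=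
        (hanti.measure_iInter (fun n => isClosed_closure.measurableSet.nullMeasurableSet)
          ⟨0, measure_ne_top _ _⟩).symm
    _ ≤ μ (f '' K) := measure_mono hsub

lemma aux_analytic {Y : Type*} [TopologicalSpace Y] [T2Space Y] [MeasurableSpace Y] [BorelSpace Y]
    (μ : Measure Y) [IsFiniteMeasure μ] (A : Set Y) (hA : AnalyticSet A) :
    NullMeasurableSet A μ := by
  rw [AnalyticSet] at hA
  rcases hA with rfl | ⟨f, hf, rfl⟩
  · exact MeasurableSet.empty.nullMeasurableSet
  by_cases h0 : μ (Set.range f) = 0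
  · exact NullMeasurableSet.of_null h0
  obtain ⟨c, -, hc, hlim⟩ := exists_seq_strictMono_tendsto' (pos_iff_ne_zero.2 h0)
  choose K hKm hKs hKc using fun n => aux_inner μ f hf (c n) (hc n).2
  have hle : μ (Set.range f) ≤ μ (⋃ n, K n) := by
    apply le_of_tendsto' hlim
    intro n
    exact (hKc n).trans (measure_mono (Set.subset_iUnion _ _))
  have hsub : (⋃ n, K n) ⊆ Set.range f := Set.iUnion_subset hKs
  have h1 : (⋃ n, K n : Set Y) =ᵐ[μ] toMeasurable μ (Set.range f) := by
    apply ae_eq_of_subset_of_measure_ge (hsub.trans (subset_toMeasurable _ _))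
    · rw [measure_toMeasurable]; exact hle
    · exact (MeasurableSet.iUnion hKm).nullMeasurableSet
    · exact measure_ne_top _ _
  have h2 : (⋃ n, K n : Set Y) =ᵐ[μ] Set.range f := by
    apply EventuallyLE.antisymm
    · exact Eventually.of_forall hsub
    · exact (EventuallyLE.trans (Eventually.of_forall (subset_toMeasurable _ _)) h1.symm.le)
  exact (MeasurableSet.iUnion hKm).nullMeasurableSet.congr h2

lemma aux_factor {X S : Type*} [MeasurableSpace X] [MeasurableSpace S] (E : Set (X × S))
    (hE : MeasurableSet E) : ∃ (Y : Type) (_ : MeasurableSpace Y) (_ : StandardBorelSpace Y)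
      (q : S → Y) (E' : Set (X × Y)), Measurable q ∧ MeasurableSet E' ∧
        E = (fun p : X × S => (p.1, q p.2)) ⁻¹' E' := by
  induction E, hE using MeasurableSpace.induction_on_inter generateFrom_prod.symm isPiSystem_prod with
  | empty =>
    exact ⟨Unit, inferInstance, inferInstance, fun _ => (), ∅, measurable_const, .empty, by simp⟩
  | basic t ht =>
    obtain ⟨s, hs, t, ht, rfl⟩ := ht
    classical
    refine ⟨Prop, inferInstance, inferInstance, fun x => x ∈ t, s ×ˢ {True}, ?_, ?_, ?_⟩
    · exact measurable_mem.2 ht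
    · exact MeasurableSet.prod hs (MeasurableSet.of_discrete)
    · ext ⟨x, y⟩; simp
  | compl t ht ih =>
    obtain ⟨Y, i1, i2, q, E', hq, hE', rfl⟩ := ih
    exact ⟨Y, i1, i2, q, E'ᶜ, hq, hE'.compl, rfl⟩
  | iUnion f hd hm ih =>
    choose Y i1 i2 q E' hq hE' he using ih
    refine ⟨∀ n, Y n, inferInstance, inferInstance, fun s n => q n s,
      ⋃ n, (fun p : X × (∀ n, Y n) => (p.1, p.2 n)) ⁻¹' E' n, ?_, ?_, ?_⟩
    · exact measurable_pi_lambda _ hq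
    · refine MeasurableSet.iUnion fun n => ?_
      exact (measurable_fst.prodMk ((measurable_pi_apply n).comp measurable_snd)) (hE' n)
    · rw [Set.preimage_iUnion]
      exact Set.iUnion_congr fun n => he n

lemma aux_proj {X S : Type*} [MeasurableSpace X] [StandardBorelSpace X] [MeasurableSpace S]
    (ρ : Measure S) [SigmaFinite ρ] (E : Set (X × S))
    (hE : MeasurableSet E) : NullMeasurableSet {σ | ∃ x, (x, σ) ∈ E} ρ := by
  obtain ⟨Y, i1, i2, q, E', hq, hE', rfl⟩ := aux_factor E hE
  obtain ⟨ν, hν, hac, -⟩ := exists_isFiniteMeasure_absolutelyContinuous ρ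
  refine NullMeasurableSet.mono_ac ?_ hac
  let := upgradeStandardBorel Y
  have han : AnalyticSet (Prod.snd '' E') := hE'.analyticSet_image measurable_snd
  have h1 := aux_analytic (ν.map q) _ han
  have h2 := h1.preimage (hq.measurePreserving ν).quasiMeasurePreserving
  convert h2 using 1
  ext σ
  simp

lemma aux_sup {X S : Type*} [MeasurableSpace X] [StandardBorelSpace X] [MeasurableSpace S]
    (ρ : Measure S) [SigmaFinite ρ] (F : X × S → ℝ≥0∞) (hF : Measurable F) :
    AEMeasurable (fun σ => ⨆ x, F (x, σ)) ρ := by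
  apply NullMeasurable.aemeasurable
  have : Measurable[_] (fun σ : NullMeasurableSpace S ρ => (⨆ x, F (x, σ) : ℝ≥0∞)) := by
    apply measurable_of_Ioi
    intro a
    have h := aux_proj ρ (F ⁻¹' Set.Ioi a) (hF measurableSet_Ioi)
    have he : (fun σ => ⨆ x, F (x, σ)) ⁻¹' Set.Ioi a = {σ | ∃ x, (x, σ) ∈ F ⁻¹' Set.Ioi a} := by
      ext σ
      simp [lt_iSup_iff]
    rw [← he] at h
    exact h
  intro s hs
  exact this hs

/-- A decomposition of `φ` with cost `c`. -/
def AuxDec {m : ℕ} {X : Type} [MeasurableSpace X] (φ : (Fin m → X) → ℂ) (c : ℝ≥0∞) : Prop :=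
  ∃ (S : Type) (_ : MeasurableSpace S) (ρ : MeasureTheory.Measure S)
      (φs : ∀ _ : Fin m, X × S → ℂ),
      MeasureTheory.SigmaFinite ρ ∧ (∀ i, Measurable (φs i)) ∧
      (∀ i σ, ∃ C : ℝ, ∀ ω, ‖φs i (ω, σ)‖ ≤ C) ∧
      (∫⁻ σ, ∏ i, ⨆ ω, (‖φs i (ω, σ)‖₊ : ℝ≥0∞) ∂ρ) ≠ ∞ ∧
      (∀ ω : Fin m → X, φ ω = ∫ σ, ∏ i, φs i (ω i, σ) ∂ρ) ∧
      c = ∫⁻ σ, ∏ i, ⨆ ω, (‖φs i (ω, σ)‖₊ : ℝ≥0∞) ∂ρ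

lemma aux_ipt_eq {m : ℕ} {X : Type} [MeasurableSpace X] (φ : (Fin m → X) → ℂ) :
    iptNorm (Ω := fun _ : Fin m => X) φ = sInf {c | AuxDec φ c} := rfl

lemma AuxDec.ne_top {m : ℕ} {X : Type} [MeasurableSpace X] {φ : (Fin m → X) → ℂ} {c : ℝ≥0∞}
    (h : AuxDec φ c) : c ≠ ∞ := by
  obtain ⟨S, _, ρ, φs, h1, h2, h3, h4, h5, rfl⟩ := h
  exact h4

lemma aux_prod_le {m : ℕ} {X S : Type} (φs : Fin m → X × S → ℂ) (ω : Fin m → X) (σ : S) :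
    ‖∏ i, φs i (ω i, σ)‖ₑ ≤ ∏ i, ⨆ ω, (‖φs i (ω, σ)‖₊ : ℝ≥0∞) := by
  have : ‖∏ i, φs i (ω i, σ)‖ₑ = ∏ i, (‖φs i (ω i, σ)‖₊ : ℝ≥0∞) := by
    rw [enorm_eq_nnnorm, nnnorm_prod]; push_cast; rfl
  rw [this]
  exact Finset.prod_le_prod' fun i _ => le_iSup (fun x => (‖φs i (x, σ)‖₊ : ℝ≥0∞)) (ω i)

lemma aux_integrable {m : ℕ} {X S : Type} [MeasurableSpace X] [MeasurableSpace S] (ρ : Measure S)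
    (φs : Fin m → X × S → ℂ) (hm : ∀ i, Measurable (φs i))
    (h : (∫⁻ σ, ∏ i, ⨆ ω, (‖φs i (ω, σ)‖₊ : ℝ≥0∞) ∂ρ) ≠ ∞) (ω : Fin m → X) :
    Integrable (fun σ => ∏ i, φs i (ω i, σ)) ρ := by
  refine ⟨?_, ?_⟩
  · apply Measurable.aestronglyMeasurable
    exact Finset.measurable_fun_prod _ fun i _ => (hm i).comp (measurable_const.prodMk measurable_id)
  · refine lt_of_le_of_lt ?_ (lt_top_iff_ne_top.2 h)
    exact lintegral_mono fun σ => aux_prod_le φs ω σ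

lemma AuxDec.enorm_le {m : ℕ} {X : Type} [MeasurableSpace X] {φ : (Fin m → X) → ℂ} {c : ℝ≥0∞}
    (h : AuxDec φ c) (ω : Fin m → X) : ‖φ ω‖ₑ ≤ c := by
  obtain ⟨S, _, ρ, φs, h1, h2, h3, h4, h5, rfl⟩ := h
  rw [h5]
  exact (enorm_integral_le_lintegral_enorm _).trans (lintegral_mono fun σ => aux_prod_le φs ω σ)

lemma aux_dec_zero {m : ℕ} {X : Type} [MeasurableSpace X] :
    AuxDec (fun _ : Fin m → X => 0) 0 :=
  ⟨Unit, inferInstance, 0, fun _ _ => 0, inferInstance, fun _ => measurable_const,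
    fun _ _ => ⟨0, by simp⟩, by simp, by simp, by simp⟩

lemma AuxDec.add {m : ℕ} {X : Type} [MeasurableSpace X] {φ ψ : (Fin m → X) → ℂ} {a b : ℝ≥0∞}
    (h : AuxDec φ a) (h' : AuxDec ψ b) : AuxDec (fun ω => φ ω + ψ ω) (a + b) := by
  obtain ⟨S, _, ρ, φs, h1, h2, h3, h4, h5, rfl⟩ := h
  obtain ⟨T, _, τ, ψs, k1, k2, k3, k4, k5, rfl⟩ := h'
  have el : MeasurableEmbedding (Sum.inl : S → S ⊕ T) :=
    ⟨Sum.inl_injective, measurable_inl, fun _ hs => hs.inl_image⟩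
  have er : MeasurableEmbedding (Sum.inr : T → S ⊕ T) :=
    ⟨Sum.inr_injective, measurable_inr, fun _ hs => hs.inr_image⟩
  let χ : Fin m → X × (S ⊕ T) → ℂ := fun i p =>
    Sum.elim (fun s => φs i (p.1, s)) (fun t => ψs i (p.1, t)) p.2
  have hχ : ∀ i, Measurable (χ i) := by
    intro i
    have hh : Measurable ((Sum.elim (φs i) (ψs i)) ∘ (MeasurableEquiv.prodSumDistrib X S T)) :=
      (Measurable.sumElim (h2 i) (k2 i)).comp (MeasurableEquiv.measurable _)
    convert hh using 1
    ext ⟨x, s | t⟩ <;> rfl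
  have hcost : (∫⁻ σ, ∏ i, ⨆ ω, (‖χ i (ω, σ)‖₊ : ℝ≥0∞) ∂(ρ.map Sum.inl + τ.map Sum.inr)) =
      (∫⁻ σ, ∏ i, ⨆ ω, (‖φs i (ω, σ)‖₊ : ℝ≥0∞) ∂ρ) +
      (∫⁻ σ, ∏ i, ⨆ ω, (‖ψs i (ω, σ)‖₊ : ℝ≥0∞) ∂τ) := by
    rw [lintegral_add_measure, el.lintegral_map, er.lintegral_map]
    simp [χ]
  have s1 : SigmaFinite (ρ.map (Sum.inl : S → S ⊕ T)) := el.sigmaFinite_map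
  have s2 : SigmaFinite (τ.map (Sum.inr : T → S ⊕ T)) := er.sigmaFinite_map
  refine ⟨S ⊕ T, inferInstance, ρ.map Sum.inl + τ.map Sum.inr, χ, inferInstance, hχ, ?_, ?_, ?_,
    hcost.symm⟩
  · rintro i (s | t)
    · exact h3 i s
    · exact k3 i t
  · rw [hcost]; exact ENNReal.add_ne_top.2 ⟨h4, k4⟩
  · intro ω
    rw [integral_add_measure, el.integral_map, er.integral_map]
    · simp [χ, h5, k5]
    · rw [el.integrable_map_iff]; exact aux_integrable ρ φs h2 h4 ω
    · rw [er.integrable_map_iff]; exact aux_integrable τ ψs k2 k4 ω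

lemma aux_prod_extend {M : Type*} [CommMonoid M] {a n : ℕ} (e : Fin a → Fin n)
    (he : Function.Injective e) (F : Fin a → M) :
    ∏ i, Function.extend e F 1 i = ∏ i, F i := by
  symm
  apply Fintype.prod_of_injective e he
  · intro i hi
    rw [Function.extend_apply' _ _ _ (by simpa using hi)]; rfl
  · intro i; rw [he.extend_apply]

lemma AuxDec.mul {a b n : ℕ} {X : Type} [MeasurableSpace X] [StandardBorelSpace X]
    {φ : (Fin a → X) → ℂ} {ψ : (Fin b → X) → ℂ} {A B : ℝ≥0∞}
    (h : AuxDec φ A) (h' : AuxDec ψ B) (e : Fin a → Fin n) (he : Function.Injective e)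
    (e' : Fin b → Fin n) (he' : Function.Injective e') :
    ∃ c ≤ A * B, AuxDec (fun ω : Fin n → X => φ (fun i => ω (e i)) * ψ (fun i => ω (e' i))) c := by
  obtain ⟨S, _, ρ, φs, h1, h2, h3, h4, h5, rfl⟩ := h
  obtain ⟨T, _, τ, ψs, k1, k2, k3, k4, k5, rfl⟩ := h'
  let χ1 : Fin n → X × S → ℂ := fun i p => Function.extend e (fun i => φs i p) 1 i
  let χ2 : Fin n → X × T → ℂ := fun i p => Function.extend e' (fun i => ψs i p) 1 i
  let χ : Fin n → X × (S × T) → ℂ := fun i p => χ1 i (p.1, p.2.1) * χ2 i (p.1, p.2.2)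
  have m1 : ∀ i, Measurable (χ1 i) := by
    intro i
    by_cases hi : ∃ j, e j = i
    · obtain ⟨j, rfl⟩ := hi
      have : χ1 (e j) = φs j := by funext p; simp [χ1, he.extend_apply]
      rw [this]; exact h2 j
    · have : χ1 i = fun _ => 1 := by funext p; simp [χ1, Function.extend_apply' _ _ _ hi]
      rw [this]; exact measurable_const
  have m2 : ∀ i, Measurable (χ2 i) := by
    intro i
    by_cases hi : ∃ j, e' j = i
    · obtain ⟨j, rfl⟩ := hi
      have : χ2 (e' j) = ψs j := by funext p; simp [χ2, he'.extend_apply]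
      rw [this]; exact k2 j
    · have : χ2 i = fun _ => 1 := by funext p; simp [χ2, Function.extend_apply' _ _ _ hi]
      rw [this]; exact measurable_const
  have b1 : ∀ i σ, ∃ C : ℝ, ∀ ω, ‖χ1 i (ω, σ)‖ ≤ C := by
    intro i σ
    by_cases hi : ∃ j, e j = i
    · obtain ⟨j, rfl⟩ := hi
      simpa [χ1, he.extend_apply] using h3 j σ
    · exact ⟨1, by simp [χ1, Function.extend_apply' _ _ _ hi]⟩
  have b2 : ∀ i σ, ∃ C : ℝ, ∀ ω, ‖χ2 i (ω, σ)‖ ≤ C := by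
    intro i σ
    by_cases hi : ∃ j, e' j = i
    · obtain ⟨j, rfl⟩ := hi
      simpa [χ2, he'.extend_apply] using k3 j σ
    · exact ⟨1, by simp [χ2, Function.extend_apply' _ _ _ hi]⟩
  have p1 : ∀ σ, ∏ i, ⨆ ω, (‖χ1 i (ω, σ)‖₊ : ℝ≥0∞) ≤ ∏ i, ⨆ ω, (‖φs i (ω, σ)‖₊ : ℝ≥0∞) := by
    intro σ
    rw [← aux_prod_extend e he]
    refine Finset.prod_le_prod' fun i _ => ?_
    by_cases hi : ∃ j, e j = i
    · obtain ⟨j, rfl⟩ := hi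
      simp [χ1, he.extend_apply]
    · rw [Function.extend_apply' _ _ _ hi]
      refine iSup_le fun ω => ?_
      simp [χ1, Function.extend_apply' _ _ _ hi]
  have p2 : ∀ σ, ∏ i, ⨆ ω, (‖χ2 i (ω, σ)‖₊ : ℝ≥0∞) ≤ ∏ i, ⨆ ω, (‖ψs i (ω, σ)‖₊ : ℝ≥0∞) := by
    intro σ
    rw [← aux_prod_extend e' he']
    refine Finset.prod_le_prod' fun i _ => ?_
    by_cases hi : ∃ j, e' j = i
    · obtain ⟨j, rfl⟩ := hi
      simp [χ2, he'.extend_apply]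
    · rw [Function.extend_apply' _ _ _ hi]
      refine iSup_le fun ω => ?_
      simp [χ2, Function.extend_apply' _ _ _ hi]
  have hcost : (∫⁻ σ, ∏ i, ⨆ ω, (‖χ i (ω, σ)‖₊ : ℝ≥0∞) ∂(ρ.prod τ)) ≤
      (∫⁻ σ, ∏ i, ⨆ ω, (‖φs i (ω, σ)‖₊ : ℝ≥0∞) ∂ρ) *
      (∫⁻ σ, ∏ i, ⨆ ω, (‖ψs i (ω, σ)‖₊ : ℝ≥0∞) ∂τ) := by
    rw [← lintegral_prod_mul]
    · refine lintegral_mono fun p => ?_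
      refine le_trans ?_ (mul_le_mul' (p1 p.1) (p2 p.2))
      rw [← Finset.prod_mul_distrib]
      refine Finset.prod_le_prod' fun i _ => iSup_le fun ω => ?_
      have : (‖χ i (ω, p)‖₊ : ℝ≥0∞) = ‖χ1 i (ω, p.1)‖₊ * ‖χ2 i (ω, p.2)‖₊ := by
        simp [χ]
      rw [this]
      exact mul_le_mul' (le_iSup (fun ω => (‖χ1 i (ω, p.1)‖₊ : ℝ≥0∞)) ω)
        (le_iSup (fun ω => (‖χ2 i (ω, p.2)‖₊ : ℝ≥0∞)) ω)
    · refine Finset.aemeasurable_fun_prod _ fun i _ => ?_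
      exact aux_sup ρ (fun p => (‖φs i p‖₊ : ℝ≥0∞)) (h2 i).nnnorm.coe_nnreal_ennreal
    · refine Finset.aemeasurable_fun_prod _ fun i _ => ?_
      exact aux_sup τ (fun p => (‖ψs i p‖₊ : ℝ≥0∞)) (k2 i).nnnorm.coe_nnreal_ennreal
  refine ⟨_, hcost, S × T, inferInstance, ρ.prod τ, χ, inferInstance, ?_, ?_, ?_, ?_, rfl⟩
  · intro i
    exact ((m1 i).comp (measurable_fst.prodMk (measurable_fst.comp measurable_snd))).mul
      ((m2 i).comp (measurable_fst.prodMk (measurable_snd.comp measurable_snd)))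
  · intro i σ
    obtain ⟨C, hC⟩ := b1 i σ.1
    obtain ⟨D, hD⟩ := b2 i σ.2
    refine ⟨C * D, fun ω => ?_⟩
    rw [norm_mul]
    exact mul_le_mul (hC ω) (hD ω) (norm_nonneg _) ((norm_nonneg _).trans (hC ω))
  · exact ne_top_of_le_ne_top (ENNReal.mul_ne_top h4 k4) hcost
  · intro ω
    beta_reduce
    rw [h5, k5, ← integral_prod_mul]
    congr 1
    funext p
    rw [Finset.prod_mul_distrib]
    have q1 : ∀ i, χ1 i (ω i, p.1) = Function.extend e (fun j => φs j (ω (e j), p.1)) 1 i := by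
      intro i
      by_cases hi : ∃ j, e j = i
      · obtain ⟨j, rfl⟩ := hi
        simp [χ1, he.extend_apply]
      · simp [χ1, Function.extend_apply' _ _ _ hi]
    have q2 : ∀ i, χ2 i (ω i, p.2) = Function.extend e' (fun j => ψs j (ω (e' j), p.2)) 1 i := by
      intro i
      by_cases hi : ∃ j, e' j = i
      · obtain ⟨j, rfl⟩ := hi
        simp [χ2, he'.extend_apply]
      · simp [χ2, Function.extend_apply' _ _ _ hi]
    simp only [q1, q2]
    rw [aux_prod_extend e he, aux_prod_extend e' he']

lemma aux_ipt_zero {m : ℕ} {X : Type} [MeasurableSpace X] :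
    iptNorm (Ω := fun _ : Fin m => X) (fun _ => 0) = 0 := by
  rw [aux_ipt_eq]
  exact le_antisymm (sInf_le aux_dec_zero) (zero_le)

lemma aux_eq_zero {m : ℕ} {X : Type} [MeasurableSpace X] {φ : (Fin m → X) → ℂ}
    (h : iptNorm (Ω := fun _ : Fin m => X) φ = 0) (ω : Fin m → X) : φ ω = 0 := by
  have : ‖φ ω‖ₑ ≤ 0 := by
    rw [← h, aux_ipt_eq]
    exact le_sInf fun c hc => AuxDec.enorm_le hc ω
  simpa using this

lemma aux_ipt_mul {a b n : ℕ} {X : Type} [MeasurableSpace X] [StandardBorelSpace X]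
    (φ : (Fin a → X) → ℂ) (ψ : (Fin b → X) → ℂ)
    (e : Fin a → Fin n) (he : Function.Injective e)
    (e' : Fin b → Fin n) (he' : Function.Injective e') :
    iptNorm (Ω := fun _ : Fin n => X) (fun ω => φ (fun i => ω (e i)) * ψ (fun i => ω (e' i))) ≤
      iptNorm (Ω := fun _ : Fin a => X) φ * iptNorm (Ω := fun _ : Fin b => X) ψ := by
  by_cases hA : iptNorm (Ω := fun _ : Fin a => X) φ = 0
  · have : (fun ω : Fin n → X => φ (fun i => ω (e i)) * ψ (fun i => ω (e' i))) = fun _ => 0 := by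
      funext ω; rw [aux_eq_zero hA, zero_mul]
    rw [this, aux_ipt_zero]; exact zero_le
  by_cases hB : iptNorm (Ω := fun _ : Fin b => X) ψ = 0
  · have : (fun ω : Fin n → X => φ (fun i => ω (e i)) * ψ (fun i => ω (e' i))) = fun _ => 0 := by
      funext ω; rw [aux_eq_zero hB, mul_zero]
    rw [this, aux_ipt_zero]; exact zero_le
  by_cases hA' : iptNorm (Ω := fun _ : Fin a => X) φ = ∞
  · rw [hA', ENNReal.top_mul hB]; exact le_top
  by_cases hB' : iptNorm (Ω := fun _ : Fin b => X) ψ = ∞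
  · rw [hB', ENNReal.mul_top hA]; exact le_top
  rw [← ENNReal.div_le_iff hB hB']
  rw [aux_ipt_eq φ]
  refine le_sInf fun c hc => ?_
  rw [ENNReal.div_le_iff hB hB', mul_comm]
  have hc0 : c ≠ 0 := by
    rintro rfl
    exact hA (le_antisymm (sInf_le hc) zero_le)
  have hct : c ≠ ∞ := AuxDec.ne_top hc
  rw [← ENNReal.div_le_iff hc0 hct, aux_ipt_eq ψ]
  refine le_sInf fun d hd => ?_
  rw [ENNReal.div_le_iff hc0 hct, mul_comm]
  obtain ⟨x, hx, hx'⟩ := AuxDec.mul hc hd e he e' he'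
  rw [aux_ipt_eq]
  exact le_trans (sInf_le (Set.mem_ofPred_eq ▸ hx')) hx

lemma aux_ipt_add {m : ℕ} {X : Type} [MeasurableSpace X] (φ ψ : (Fin m → X) → ℂ) :
    iptNorm (Ω := fun _ : Fin m => X) (fun ω => φ ω + ψ ω) ≤
      iptNorm (Ω := fun _ : Fin m => X) φ + iptNorm (Ω := fun _ : Fin m => X) ψ := by
  rw [aux_ipt_eq φ, aux_ipt_eq ψ, ENNReal.sInf_add]
  refine le_iInf₂ fun c hc => ?_
  rw [add_comm, ENNReal.sInf_add]
  refine le_iInf₂ fun d hd => ?_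
  rw [add_comm]
  exact sInf_le (AuxDec.add hc hd)

lemma aux_ipt_sum {m : ℕ} {X : Type} [MeasurableSpace X] {ι : Type*} (s : Finset ι)
    (φ : ι → (Fin m → X) → ℂ) :
    iptNorm (Ω := fun _ : Fin m => X) (fun ω => ∑ j ∈ s, φ j ω) ≤
      ∑ j ∈ s, iptNorm (Ω := fun _ : Fin m => X) (φ j) := by
  classical
  induction s using Finset.induction_on with
  | empty => simp only [Finset.sum_empty]; rw [aux_ipt_zero]
  | insert a s ha ih =>
    simp only [Finset.sum_insert ha]
    exact (aux_ipt_add _ _).trans (add_le_add le_rfl ih)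

/-- The standard simplex used in `divDiffC`. -/
def auxSx (k : ℕ) : Set (Fin k → ℝ) := {s : Fin k → ℝ | (∀ i, 0 ≤ s i) ∧ ∑ i, s i ≤ 1}

lemma auxSx_compact (k : ℕ) : IsCompact (auxSx k) := by
  have h1 : IsCompact (Set.Icc (0 : Fin k → ℝ) 1) := isCompact_Icc
  refine h1.of_isClosed_subset ?_ ?_
  · have : auxSx k = (⋂ i, {s | 0 ≤ s i}) ∩ {s | ∑ i, s i ≤ 1} := by
      ext s; simp [auxSx]
    rw [this]
    refine IsClosed.inter (isClosed_iInter fun i => ?_) ?_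
    · exact isClosed_le continuous_const (continuous_apply i)
    · exact isClosed_le (by fun_prop) continuous_const
  · rintro s ⟨hs, hs'⟩
    refine ⟨fun i => hs i, fun i => ?_⟩
    exact (Finset.single_le_sum (fun j _ => hs j) (Finset.mem_univ i)).trans hs'

lemma aux_fiber (k : ℕ) (G : (Fin (k + 1) → ℝ) → ℂ) (hG : Continuous G) :
    ∫ s in auxSx (k + 1), G s =
      ∫ s in auxSx k, ∫ t in (0 : ℝ)..(1 - ∑ i, s i), G (Fin.cons t s) := by
  have hm1 := (auxSx_compact (k + 1)).measurableSet
  have hm := (auxSx_compact k).measurableSet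
  rw [← integral_indicator hm1, ← integral_indicator hm]
  have hIntG : Integrable ((auxSx (k + 1)).indicator G) :=
    (integrable_indicator_iff hm1).2 (hG.continuousOn.integrableOn_compact (auxSx_compact _))
  have e := volume_preserving_piFinSuccAbove (fun _ : Fin (k + 1) => ℝ) 0
  rw [← e.symm.integral_comp' (g := (auxSx (k + 1)).indicator G)]
  have hIntG2 : Integrable (fun p => (auxSx (k + 1)).indicator G
      ((MeasurableEquiv.piFinSuccAbove (fun _ : Fin (k + 1) => ℝ) 0).symm p)) :=
    (e.symm.integrable_comp_emb (MeasurableEquiv.measurableEmbedding _)).2 hIntG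
  rw [Measure.volume_eq_prod] at hIntG2 ⊢
  rw [integral_prod_symm _ hIntG2]
  congr 1
  funext y
  have hcons : ∀ t : ℝ, (MeasurableEquiv.piFinSuccAbove (fun _ : Fin (k + 1) => ℝ) 0).symm (t, y)
      = Fin.cons t y := by
    intro t
    simp [MeasurableEquiv.piFinSuccAbove, Fin.insertNthEquiv]
  simp only [hcons]
  have hmem : ∀ t : ℝ, (Fin.cons t y : Fin (k + 1) → ℝ) ∈ auxSx (k + 1) ↔
      0 ≤ t ∧ (∀ i, 0 ≤ y i) ∧ t + ∑ i, y i ≤ 1 := by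
    intro t
    simp only [auxSx, Set.mem_ofPred_eq, Fin.forall_fin_succ, Fin.sum_univ_succ, Fin.cons_zero,
      Fin.cons_succ, and_assoc]
  by_cases hy : y ∈ auxSx k
  · rw [Set.indicator_of_mem hy, intervalIntegral.integral_of_le (by linarith [hy.2]),
      ← integral_Icc_eq_integral_Ioc, ← integral_indicator measurableSet_Icc]
    congr 1
    funext t
    by_cases ht : t ∈ Set.Icc 0 (1 - ∑ i, y i)
    · rw [Set.indicator_of_mem ht, Set.indicator_of_mem]
      exact (hmem t).2 ⟨ht.1, hy.1, by linarith [ht.2]⟩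
    · rw [Set.indicator_of_notMem ht, Set.indicator_of_notMem]
      intro h
      have := (hmem t).1 h
      exact ht ⟨this.1, by linarith [this.2.2]⟩
  · rw [Set.indicator_of_notMem hy]
    have : ∀ t : ℝ, (auxSx (k + 1)).indicator G (Fin.cons t y) = 0 := by
      intro t
      rw [Set.indicator_of_notMem]
      intro h
      have := (hmem t).1 h
      exact hy ⟨this.2.1, by linarith [this.2.2, this.1]⟩
    simp [this]

/-- Divided difference with the last node separated. -/
noncomputable def auxL (f : ℝ → ℂ) (k : ℕ) (w : Fin k → ℝ) (a : ℝ) : ℂ :=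
  ∫ s in auxSx k, iteratedDeriv k f ((∑ i, s i * w i) + (1 - ∑ i, s i) * a)

lemma auxL_eq (f : ℝ → ℂ) (k : ℕ) (lam : Fin (k + 1) → ℝ) :
    divDiffC f k lam = auxL f k (fun i => lam i.castSucc) (lam (Fin.last k)) := rfl

lemma auxL_perm (f : ℝ → ℂ) (k : ℕ) (w : Fin k → ℝ) (a : ℝ) (σ : Equiv.Perm (Fin k)) :
    auxL f k (fun i => w (σ i)) a = auxL f k w a := by
  have e := volume_measurePreserving_piCongrLeft (fun _ : Fin k => ℝ) σ
  unfold auxL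
  symm
  rw [← e.setIntegral_preimage_emb (MeasurableEquiv.measurableEmbedding _)]
  have happ : ∀ (s : Fin k → ℝ) i, MeasurableEquiv.piCongrLeft (fun _ : Fin k => ℝ) σ s (σ i) = s i :=
    fun s i => by
      rw [MeasurableEquiv.coe_piCongrLeft]
      exact Equiv.piCongrLeft_apply_apply (fun _ : Fin k => ℝ) σ s i
  have hsum : ∀ s : Fin k → ℝ, ∑ i, MeasurableEquiv.piCongrLeft (fun _ : Fin k => ℝ) σ s i
      = ∑ i, s i := by
    intro s
    rw [← Equiv.sum_comp σ]
    simp only [happ]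
  have hsum2 : ∀ s : Fin k → ℝ, ∑ i, MeasurableEquiv.piCongrLeft (fun _ : Fin k => ℝ) σ s i * w i
      = ∑ i, s i * w (σ i) := by
    intro s
    rw [← Equiv.sum_comp σ]
    simp only [happ]
  have hset : (MeasurableEquiv.piCongrLeft (fun _ : Fin k => ℝ) σ) ⁻¹' auxSx k = auxSx k := by
    ext s
    simp only [auxSx, Set.mem_preimage, Set.mem_ofPred_eq, hsum]
    rw [← σ.forall_congr_right]
    simp only [happ]
  rw [hset]
  simp only [hsum, hsum2]

lemma auxL_fiber (f : ℝ → ℂ) (k : ℕ) (hf : ContDiff ℝ ((k + 1 : ℕ) : ℕ∞) f) (u : Fin k → ℝ)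
    (a b : ℝ) : auxL f (k + 1) (Fin.cons a u) b =
      ∫ s in auxSx k, ∫ t in (0 : ℝ)..(1 - ∑ i, s i),
        iteratedDeriv (k + 1) f (t * a + (∑ i, s i * u i) + (1 - ∑ i, s i - t) * b) := by
  have hc : Continuous (iteratedDeriv (k + 1) f) :=
    hf.continuous_iteratedDeriv (k + 1) (by exact_mod_cast le_rfl)
  unfold auxL
  rw [aux_fiber]
  · simp only [Fin.sum_univ_succ, Fin.cons_zero, Fin.cons_succ]
    congr 1
    funext s
    congr 1
    funext t
    congr 1
    ring
  · exact hc.comp (by fun_prop)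

lemma auxL_swap (f : ℝ → ℂ) (k : ℕ) (hf : ContDiff ℝ ((k + 1 : ℕ) : ℕ∞) f) (u : Fin k → ℝ)
    (a b : ℝ) : auxL f (k + 1) (Fin.cons a u) b = auxL f (k + 1) (Fin.cons b u) a := by
  rw [auxL_fiber f k hf, auxL_fiber f k hf]
  congr 1
  funext s
  have h := intervalIntegral.integral_comp_sub_left (a := 0) (b := 1 - ∑ i, s i) (fun t =>
    iteratedDeriv (k + 1) f (t * a + (∑ i, s i * u i) + (1 - ∑ i, s i - t) * b)) (1 - ∑ i, s i)
  rw [sub_self, sub_zero] at h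
  rw [← h]
  congr 1
  funext t
  congr 1
  ring

lemma auxL_cont (f : ℝ → ℂ) (k : ℕ) (hf : ContDiff ℝ (k : ℕ∞) f) :
    Continuous (fun p : (Fin k → ℝ) × ℝ => auxL f k p.1 p.2) := by
  have hc : Continuous (iteratedDeriv k f) :=
    hf.continuous_iteratedDeriv k (by exact_mod_cast le_rfl)
  unfold auxL
  refine continuous_parametric_integral_of_continuous (μ := volume) (f := fun (p : (Fin k → ℝ) × ℝ) s =>
    iteratedDeriv k f ((∑ i, s i * p.1 i) + (1 - ∑ i, s i) * p.2)) ?_ (auxSx_compact k)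
  exact hc.comp (by fun_prop)

lemma auxL_rec (f : ℝ → ℂ) (k : ℕ) (hf : ContDiff ℝ ((k + 1 : ℕ) : ℕ∞) f) (u : Fin k → ℝ)
    (a b : ℝ) : ((a - b : ℝ) : ℂ) * auxL f (k + 1) (Fin.cons a u) b =
      auxL f k u a - auxL f k u b := by
  have hc1 : Continuous (iteratedDeriv (k + 1) f) :=
    hf.continuous_iteratedDeriv (k + 1) (by exact_mod_cast le_rfl)
  have hc : Continuous (iteratedDeriv k f) :=
    hf.continuous_iteratedDeriv k (by exact_mod_cast Nat.le_succ k)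
  have hd : Differentiable ℝ (iteratedDeriv k f) :=
    hf.differentiable_iteratedDeriv k (by exact_mod_cast Nat.lt_succ_self k)
  rw [auxL_fiber f k hf]
  unfold auxL
  rw [← integral_const_mul, ← integral_sub]
  · congr 1
    funext s
    rw [← intervalIntegral.integral_const_mul]
    have hder : ∀ t : ℝ, HasDerivAt (fun t : ℝ => iteratedDeriv k f
        (t * a + (∑ i, s i * u i) + (1 - ∑ i, s i - t) * b))
        (((a - b : ℝ) : ℂ) * iteratedDeriv (k + 1) f
          (t * a + (∑ i, s i * u i) + (1 - ∑ i, s i - t) * b)) t := by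
      intro t
      have h1 := (hd (t * a + (∑ i, s i * u i) + (1 - ∑ i, s i - t) * b)).hasDerivAt
      rw [← iteratedDeriv_succ] at h1
      have h2 : HasDerivAt (fun t : ℝ => t * a + (∑ i, s i * u i) + (1 - ∑ i, s i - t) * b)
          (a - b) t := by
        have h3 := (((hasDerivAt_id t).mul_const a).add_const (∑ i, s i * u i)).add
          (((hasDerivAt_id t).const_sub (1 - ∑ i, s i)).mul_const b)
        exact h3.congr_deriv (by ring)
      have h4 := h1.scomp t h2
      rw [Complex.real_smul] at h4
      exact h4
    rw [intervalIntegral.integral_eq_sub_of_hasDerivAt (fun t _ => hder t)]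
    · beta_reduce
      congr 1 <;> (congr 1; ring)
    · apply Continuous.intervalIntegrable
      exact continuous_const.mul (hc1.comp (by fun_prop))
  · exact (hc.comp (by fun_prop)).continuousOn.integrableOn_compact (auxSx_compact k)
  · exact (hc.comp (by fun_prop)).continuousOn.integrableOn_compact (auxSx_compact k)

/-- Divided difference at consecutive nodes `x a, …, x (a+n)`. -/
noncomputable def auxD (f : ℝ → ℂ) (n : ℕ) (x : ℕ → ℝ) (a : ℕ) : ℂ :=
  auxL f n (fun i => x (a + i)) (x (a + n))

lemma auxD_eq (f : ℝ → ℂ) (n : ℕ) (x : ℕ → ℝ) (a : ℕ) :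
    divDiffC f n (fun i => x (a + i)) = auxD f n x a := rfl

lemma auxD_cont (f : ℝ → ℂ) (n : ℕ) (hf : ContDiff ℝ (n : ℕ∞) f) (a : ℕ) :
    Continuous (fun x => auxD f n x a) := by
  have h : Continuous (fun x : ℕ → ℝ => ((fun i : Fin n => x (a + i)), x (a + n))) := by fun_prop
  exact (auxL_cont f n hf).comp h

lemma aux_le {n m : ℕ} (h : n ≤ m) {f : ℝ → ℂ} (hf : ContDiff ℝ (m : ℕ∞) f) :
    ContDiff ℝ (n : ℕ∞) f := hf.of_le (by exact_mod_cast h)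

lemma auxD_rot (f : ℝ → ℂ) (n : ℕ) (hf : ContDiff ℝ (n : ℕ∞) f) (x : ℕ → ℝ) (a : ℕ) :
    auxL f n (fun i => x (a + 1 + i)) (x a) = auxD f n x a := by
  cases n with
  | zero =>
    unfold auxD
    congr 1
    funext i; exact i.elim0
  | succ n =>
    have h1 : (fun i : Fin (n + 1) => x (a + i)) =
        Fin.cons (x a) (fun i : Fin n => x (a + 1 + i)) := by
      funext i
      refine Fin.cases ?_ (fun j => ?_) i
      · simp
      · simp only [Fin.cons_succ, Fin.val_succ]; congr 1; omega
    have h2 : (fun i : Fin (n + 1) => x (a + 1 + i)) =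
        fun i => (Fin.cons (x (a + (n + 1))) (fun i : Fin n => x (a + 1 + i)) : Fin (n + 1) → ℝ)
          (finRotate _ i) := by
      rw [← Fin.snoc_eq_cons_rotate]
      funext i
      refine Fin.lastCases ?_ (fun j => ?_) i
      · simp only [Fin.snoc_last, Fin.val_last]; congr 1; omega
      · simp
    rw [h2, auxL_perm]
    unfold auxD
    rw [h1, auxL_swap f n hf]

lemma auxD_rec (f : ℝ → ℂ) (n : ℕ) (hf : ContDiff ℝ ((n + 1 : ℕ) : ℕ∞) f) (x : ℕ → ℝ) (a : ℕ) :
    ((x a : ℂ) - x (a + (n + 1))) * auxD f (n + 1) x a = auxD f n x a - auxD f n x (a + 1) := by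
  have h1 : (fun i : Fin (n + 1) => x (a + i)) =
      Fin.cons (x a) (fun i : Fin n => x (a + 1 + i)) := by
    funext i
    refine Fin.cases ?_ (fun j => ?_) i
    · simp
    · simp only [Fin.cons_succ, Fin.val_succ]; congr 1; omega
  rw [← auxD_rot f n (aux_le (Nat.le_succ n) hf)]
  have h3 := auxL_rec f n hf (fun i : Fin n => x (a + 1 + i)) (x a) (x (a + (n + 1)))
  rw [← h1] at h3
  push_cast at h3
  unfold auxD
  rw [h3]
  congr 3
  omega

lemma auxD_zero (f : ℝ → ℂ) (x : ℕ → ℝ) (a : ℕ) : auxD f 0 x a = f (x a) := by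
  unfold auxD auxL
  have : auxSx 0 = Set.univ := by ext s; simp [auxSx]
  rw [this]
  simp [integral_const, Measure.real, volume_pi]

lemma aux_leibniz (k : ℕ) (f g : ℝ → ℂ) (hf : ContDiff ℝ (k : ℕ∞) f)
    (hg : ContDiff ℝ (k : ℕ∞) g) : ∀ (x : ℕ → ℝ) (a : ℕ),
    auxD (fun t => f t * g t) k x a =
      ∑ j ∈ Finset.range (k + 1), auxD f j x a * auxD g (k - j) x (a + j) := by
  induction k with
  | zero => intro x a; simp [auxD_zero]
  | succ k ih =>
    intro x a
    have ih' := ih (aux_le (Nat.le_succ k) hf) (aux_le (Nat.le_succ k) hg)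
    have hfg : ContDiff ℝ ((k + 1 : ℕ) : ℕ∞) (fun t => f t * g t) := hf.mul hg
    set h : (ℕ → ℝ) → ℂ := fun x => auxD (fun t => f t * g t) (k + 1) x a -
      ∑ j ∈ Finset.range (k + 1 + 1), auxD f j x a * auxD g (k + 1 - j) x (a + j) with hh
    have hcont : Continuous h := by
      refine (auxD_cont _ _ hfg a).sub (continuous_finsetSum _ fun j hj => ?_)
      have hj' := Finset.mem_range.1 hj
      exact (auxD_cont f j (aux_le (by omega) hf) a).mul
        (auxD_cont g (k + 1 - j) (aux_le (by omega) hg) (a + j))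
    have key : ∀ x : ℕ → ℝ, ((x a : ℂ) - x (a + (k + 1))) * h x = 0 := by
      intro x
      rw [hh]
      simp only
      rw [mul_sub, auxD_rec _ k hfg, ih' x a, ih' x (a + 1), Finset.mul_sum]
      have e1 : ∑ j ∈ Finset.range (k + 1 + 1), ((x a : ℂ) - x (a + (k + 1))) *
          (auxD f j x a * auxD g (k + 1 - j) x (a + j)) =
          ∑ j ∈ Finset.range (k + 1 + 1), (((x a : ℂ) - x (a + j)) * auxD f j x a) *
            auxD g (k + 1 - j) x (a + j) +
          ∑ j ∈ Finset.range (k + 1 + 1), auxD f j x a *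
            (((x (a + j) : ℂ) - x (a + (k + 1))) * auxD g (k + 1 - j) x (a + j)) := by
        rw [← Finset.sum_add_distrib]
        exact Finset.sum_congr rfl fun j _ => by ring
      rw [e1, Finset.sum_range_succ' _ (k + 1), Finset.sum_range_succ (n := k + 1)]
      simp only [add_zero, sub_self, zero_mul, mul_zero]
      rw [← Finset.sum_sub_distrib, ← Finset.sum_add_distrib, ← Finset.sum_sub_distrib]
      refine Finset.sum_eq_zero fun j hj => ?_
      have hj' := Finset.mem_range.1 hj
      rw [auxD_rec f j (aux_le (by omega) hf)]
      have e2 : k + 1 - j = (k - j) + 1 := by omega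
      have e3 : a + (k + 1) = (a + j) + ((k - j) + 1) := by omega
      have e4 : k + 1 - (j + 1) = k - j := by omega
      have e5 : a + 1 + j = a + j + 1 := by omega
      have e6 : a + (j + 1) = a + j + 1 := by omega
      rw [e2, e3, auxD_rec g (k - j) (aux_le (by omega) hg), e4, e5, e6]
      ring
    have hx : h x = 0 := by
      let y : ℝ → (ℕ → ℝ) := fun t => Function.update x a t
      have hy : Continuous (fun t => h (y t)) :=
        hcont.comp (continuous_const.update a continuous_id)
      have hz : Set.EqOn (fun t => h (y t)) (fun _ => 0) {x (a + (k + 1))}ᶜ := by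
        intro t ht
        have := key (y t)
        have h1 : y t a = t := by simp [y]
        have h2 : y t (a + (k + 1)) = x (a + (k + 1)) := by simp [y]
        rw [h1, h2] at this
        rcases mul_eq_zero.1 this with h3 | h3
        · exfalso
          apply ht
          have : (t : ℂ) = x (a + (k + 1)) := sub_eq_zero.1 h3
          exact_mod_cast this
        · exact h3
      have := Continuous.ext_on (dense_compl_singleton _) hy continuous_const hz
      have h4 := congrFun this (x a)
      simpa [y] using h4
    exact sub_eq_zero.1 hx

lemma aux_main (k : ℕ) (r : ℝ) (f g : ℝ → ℂ)
    (hf : ContDiff ℝ (k : ℕ∞) f) (hg : ContDiff ℝ (k : ℕ∞) g) :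
    iptNormIcc r (divDiffC (fun x => f x * g x) k) ≤
        (∑ j ∈ Finset.range (k + 1),
          iptNormIcc r (divDiffC f j) * iptNormIcc r (divDiffC g (k - j))) := by
  have hX : StandardBorelSpace (Set.Icc (-r) r : Set ℝ) := measurableSet_Icc.standardBorel
  let X : Type := (Set.Icc (-r) r : Set ℝ)
  let e : ∀ j : ℕ, Fin (j + 1) → Fin (k + 1) := fun j i => Fin.ofNat (k + 1) (i : ℕ)
  let e' : ∀ j : ℕ, Fin (k - j + 1) → Fin (k + 1) := fun j i => Fin.ofNat (k + 1) (j + (i : ℕ))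
  have hfun : (fun ω : Fin (k + 1) → X => divDiffC (fun x => f x * g x) k (fun i => (ω i : ℝ))) =
      fun ω => ∑ j ∈ Finset.range (k + 1), (fun ω : Fin (k + 1) → X =>
        divDiffC f j (fun i => (ω (e j i) : ℝ)) *
          divDiffC g (k - j) (fun i => (ω (e' j i) : ℝ))) ω := by
    funext ω
    let x : ℕ → ℝ := fun n => (ω (Fin.ofNat (k + 1) n) : ℝ)
    have h := aux_leibniz k f g hf hg x 0
    have h1 : (fun i : Fin (k + 1) => (ω i : ℝ)) = fun i : Fin (k + 1) => x (0 + i) := by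
      funext i; simp [x]
    rw [h1, auxD_eq, h]
    refine Finset.sum_congr rfl fun j hj => ?_
    rw [← auxD_eq, ← auxD_eq]
    simp only [zero_add]
    rfl
  unfold iptNormIcc
  refine (le_of_eq (congrArg _ hfun)).trans ((aux_ipt_sum _ _).trans ?_)
  refine Finset.sum_le_sum fun j hj => ?_
  have hj' := Finset.mem_range.1 hj
  refine aux_ipt_mul (X := X) (fun ω => divDiffC f j fun i => (ω i : ℝ))
    (fun ω => divDiffC g (k - j) fun i => (ω i : ℝ)) (e j) ?_ (e' j) ?_
  · intro p q hpq
    have := congrArg Fin.val hpq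
    simp only [e, Fin.val_ofNat] at this
    rw [Nat.mod_eq_of_lt (by omega), Nat.mod_eq_of_lt (by omega)] at this
    exact Fin.ext this
  · intro p q hpq
    have := congrArg Fin.val hpq
    simp only [e', Fin.val_ofNat] at this
    rw [Nat.mod_eq_of_lt (by omega), Nat.mod_eq_of_lt (by omega)] at this
    exact Fin.ext (by omega)

/-- Proposition 3.3(iii): for `f, g ∈ C^k(ℝ)` and `r > 0`,
`‖(fg)^{[k]}‖_{r,k+1} ≤ ∑_{j=0}^k ‖f^{[j]}‖_{r,j+1} ‖g^{[k-j]}‖_{r,k-j+1}` and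
`‖fg‖_{𝒞^{[k]},r} ≤ ‖f‖_{𝒞^{[k]},r} ‖g‖_{𝒞^{[k]},r}` (in `[0,∞]`, with `0 ⬝ ∞ = 0`). -/
theorem stmt_12 (k : ℕ) (hk : 1 ≤ k) (r : ℝ) (hr : 0 < r) (f g : ℝ → ℂ)
    (hf : ContDiff ℝ (k : ℕ∞) f) (hg : ContDiff ℝ (k : ℕ∞) g) :
    iptNormIcc r (divDiffC (fun x => f x * g x) k) ≤
        (∑ j : Fin (k + 1),
          iptNormIcc r (divDiffC f j.val) * iptNormIcc r (divDiffC g (k - j.val))) ∧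
      (∑ j ∈ Finset.range (k + 1), iptNormIcc r (divDiffC (fun x => f x * g x) j)) ≤
        (∑ j ∈ Finset.range (k + 1), iptNormIcc r (divDiffC f j)) *
          (∑ j ∈ Finset.range (k + 1), iptNormIcc r (divDiffC g j)) := by
  constructor
  · rw [Fin.sum_univ_eq_sum_range (fun j =>
      iptNormIcc r (divDiffC f j) * iptNormIcc r (divDiffC g (k - j)))]
    exact aux_main k r f g hf hg
  · have h1 : ∀ j ∈ Finset.range (k + 1), iptNormIcc r (divDiffC (fun x => f x * g x) j) ≤
        ∑ i ∈ Finset.range (j + 1),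
          iptNormIcc r (divDiffC f i) * iptNormIcc r (divDiffC g (j - i)) := by
      intro j hj
      have hj' := Finset.mem_range.1 hj
      exact aux_main j r f g (aux_le (by omega) hf) (aux_le (by omega) hg)
    refine (Finset.sum_le_sum h1).trans ?_
    rw [Finset.sum_mul_sum, Finset.sum_range_diag_flip (k + 1)
      (fun i j => iptNormIcc r (divDiffC f i) * iptNormIcc r (divDiffC g j))]
    refine Finset.sum_le_sum fun i _ => Finset.sum_le_sum_of_subset ?_
    exact Finset.range_subset_range.2 (Nat.sub_le _ _)
end

section
/- Fix g ∈ C_c(ℝ) (continuous with compact support), k ∈ ℕ, and h ∈ C^k(ℝ) with h^{(k)} = g. Then h ∈ W_k(ℝ)_loc if and only if the Fourier transform ĝ belongs to L^1(ℝ). -/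
open MeasureTheory Filter
open scoped ENNReal NNReal

/-- Membership in the Wiener space `W_k(ℝ)` : `f(λ) = ∫_ℝ e^{iλξ} μ(dξ)` for a Borel complex
measure `μ` with `∫ |ξ|^k d|μ| < ∞`.  The complex measure `μ` is encoded in polar form
`μ(dξ) = h(ξ) ν(dξ)` with `ν = |μ|` a finite (positive) Borel measure and `|h| ≡ 1`. -/
def memWiener (k : ℕ) (f : ℝ → ℂ) : Prop :=
  ∃ (ν : MeasureTheory.Measure ℝ) (h : ℝ → ℂ),
    MeasureTheory.IsFiniteMeasure ν ∧ Measurable h ∧ (∀ ξ, ‖h ξ‖ = 1) ∧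
    (∫⁻ ξ, (‖ξ‖₊ : ℝ≥0∞) ^ k ∂ν) ≠ ∞ ∧
    ∀ lam : ℝ, f lam = ∫ ξ, Complex.exp (Complex.I * lam * ξ) * h ξ ∂ν

/-- The Fourier transform with the convention `f̂(ξ) = ∫_ℝ e^{-ixξ} f(x) dx`. -/
noncomputable def fourierNC (f : ℝ → ℂ) (ξ : ℝ) : ℂ :=
  ∫ x : ℝ, Complex.exp (-(Complex.I * x * ξ)) * f x
open scoped FourierTransform ContDiff Topology

lemma norm_e (x ξ : ℝ) : ‖Complex.exp (Complex.I * x * ξ)‖ = 1 := by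
  have : Complex.I * x * ξ = ((x * ξ : ℝ) : ℂ) * Complex.I := by push_cast; ring
  rw [this, Complex.norm_exp_ofReal_mul_I]

lemma norm_e' (x ξ : ℝ) : ‖Complex.exp (-(Complex.I * x * ξ))‖ = 1 := by
  have : -(Complex.I * x * ξ) = ((-(x * ξ) : ℝ) : ℂ) * Complex.I := by push_cast; ring
  rw [this, Complex.norm_exp_ofReal_mul_I]

lemma hasDerivAt_fint (ν : Measure ℝ) (F : ℝ → ℂ) (h0 : Integrable F ν)
    (h1 : Integrable (fun ξ : ℝ => (Complex.I * ξ) * F ξ) ν) (x : ℝ) :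
    HasDerivAt (fun l : ℝ => ∫ ξ, Complex.exp (Complex.I * l * ξ) * F ξ ∂ν)
      (∫ ξ, Complex.exp (Complex.I * x * ξ) * ((Complex.I * ξ) * F ξ) ∂ν) x := by
  have hm : ∀ y : ℝ, AEStronglyMeasurable (fun ξ : ℝ => Complex.exp (Complex.I * y * ξ)) ν :=
    fun y => (by fun_prop : Continuous _).aestronglyMeasurable
  refine (hasDerivAt_integral_of_dominated_loc_of_deriv_le (s := Set.univ)
    (F' := fun (x : ℝ) (ξ : ℝ) => Complex.exp (Complex.I * x * ξ) * ((Complex.I * ξ) * F ξ))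
    (bound := fun ξ => ‖(Complex.I * ξ) * F ξ‖) Filter.univ_mem ?_ ?_ ?_ ?_ h1.norm ?_).2
  · exact Eventually.of_forall fun y => (hm y).mul h0.aestronglyMeasurable
  · exact (h0.bdd_mul (c := 1) (hm x) (Eventually.of_forall fun ξ => (norm_e x ξ).le))
  · exact (hm x).mul h1.aestronglyMeasurable
  · exact Eventually.of_forall fun ξ y _ => by rw [norm_mul, norm_e, one_mul]
  · refine Eventually.of_forall fun ξ y _ => ?_
    have e1 : HasDerivAt (fun y : ℝ => Complex.I * y * ξ) (Complex.I * ξ) y := by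
      have := ((Complex.ofRealCLM.hasDerivAt (x := y)).const_mul Complex.I).mul_const (ξ : ℂ)
      simpa using this
    have := e1.cexp.mul_const (F ξ)
    rw [mul_assoc] at this
    exact this

lemma fint_deriv (k : ℕ) : ∀ (ν : Measure ℝ) (F : ℝ → ℂ)
    (_ : ∀ j ≤ k, Integrable (fun ξ : ℝ => (Complex.I * ξ) ^ j * F ξ) ν),
    ContDiff ℝ (k : ℕ∞) (fun l : ℝ => ∫ ξ, Complex.exp (Complex.I * l * ξ) * F ξ ∂ν) ∧
    iteratedDeriv k (fun l : ℝ => ∫ ξ, Complex.exp (Complex.I * l * ξ) * F ξ ∂ν) =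
      fun l : ℝ => ∫ ξ, Complex.exp (Complex.I * l * ξ) * ((Complex.I * ξ) ^ k * F ξ) ∂ν := by
  induction k with
  | zero =>
    intro ν F hF
    have h0 : Integrable F ν := by simpa using hF 0 le_rfl
    refine ⟨?_, by simp⟩
    simp only [Nat.cast_zero, WithTop.coe_zero, contDiff_zero]
    refine continuous_of_dominated (bound := fun ξ => ‖F ξ‖) ?_ ?_ h0.norm ?_
    · exact fun y => (by fun_prop : Continuous (fun ξ : ℝ => Complex.exp (Complex.I * y * ξ))).aestronglyMeasurable.mul
        h0.aestronglyMeasurable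
    · exact fun y => Eventually.of_forall fun ξ => by rw [norm_mul, norm_e, one_mul]
    · exact Eventually.of_forall fun ξ => by fun_prop
  | succ k ih =>
    intro ν F hF
    have h0 : Integrable F ν := by simpa using hF 0 (by omega)
    have h1 : Integrable (fun ξ : ℝ => (Complex.I * ξ) * F ξ) ν := by simpa using hF 1 (by omega)
    have hd := hasDerivAt_fint ν F h0 h1
    have hd' := funext fun x => (hd x).deriv
    obtain ⟨i1, i2⟩ := ih ν (fun ξ : ℝ => (Complex.I * ξ) * F ξ) (fun j hj => by
      have := hF (j+1) (by omega)
      simpa [pow_succ, mul_assoc] using this)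
    constructor
    · have : (((k+1 : ℕ) : ℕ∞) : WithTop ℕ∞) = ((k : ℕ∞) : WithTop ℕ∞) + 1 := by push_cast; rfl
      rw [this, contDiff_succ_iff_deriv, hd']
      refine ⟨fun x => (hd x).differentiableAt, ?_, i1⟩
      intro h; simp at h
    · rw [iteratedDeriv_succ', hd', i2]
      simp only [pow_succ, mul_assoc]

lemma smooth_of_iter (k : ℕ) : ∀ u : ℝ → ℂ, ContDiff ℝ (k : ℕ∞) u →
    ContDiff ℝ ∞ (iteratedDeriv k u) → ContDiff ℝ ∞ u := by
  induction k with
  | zero => intro u _ h; simpa using h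
  | succ k ih =>
    intro u h1 h2
    have : (((k+1 : ℕ) : ℕ∞) : WithTop ℕ∞) = ((k : ℕ∞) : WithTop ℕ∞) + 1 := by push_cast; rfl
    rw [this, contDiff_succ_iff_deriv] at h1
    rw [iteratedDeriv_succ'] at h2
    exact contDiff_infty_iff_deriv.2 ⟨h1.1, ih _ h1.2.2 h2⟩

lemma fourierNC_eq (f : ℝ → ℂ) (ξ : ℝ) : fourierNC f ξ = 𝓕 f (ξ / (2 * Real.pi)) := by
  rw [Real.fourier_real_eq_integral_exp_smul, fourierNC]
  congr 1; ext x
  rw [smul_eq_mul]; congr 2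
  have : (Real.pi : ℂ) ≠ 0 := by exact_mod_cast Real.pi_ne_zero
  push_cast; field_simp

lemma inversion (f : ℝ → ℂ) (hc : Continuous f) (hf : Integrable f)
    (hF : Integrable (fourierNC f)) (x : ℝ) :
    f x = ∫ ξ : ℝ, Complex.exp (Complex.I * x * ξ) * ((2 * Real.pi : ℂ)⁻¹ * fourierNC f ξ) := by
  have hpi : (Real.pi : ℂ) ≠ 0 := by exact_mod_cast Real.pi_ne_zero
  have h1 : Integrable (𝓕 f) := by
    have := hF.comp_mul_left' (R := 2 * Real.pi) (by positivity)
    refine this.congr (Eventually.of_forall fun y => ?_)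
    simp only [fourierNC_eq]
    congr 1
    field_simp
  have h2 := congrFun (hc.fourierInv_fourier_eq hf h1) x
  rw [← h2, Real.fourierInv_eq']
  have h3 := Measure.integral_comp_mul_left (fun ξ : ℝ => Complex.exp (Complex.I * x * ξ) * ((2 * Real.pi : ℂ)⁻¹ * fourierNC f ξ)) (2 * Real.pi)
  rw [abs_of_pos (by positivity)] at h3
  have h4 := congrArg (fun z : ℂ => (2 * Real.pi : ℝ) • z) h3
  beta_reduce at h4
  rw [smul_inv_smul₀ (by positivity)] at h4
  rw [← h4, ← integral_smul]
  refine integral_congr_ae (Eventually.of_forall fun y => ?_)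
  beta_reduce
  rw [fourierNC_eq]
  have : 2 * Real.pi * y / (2 * Real.pi) = y := by field_simp
  rw [this]
  simp only [Real.inner_apply, smul_eq_mul, Complex.real_smul]
  push_cast
  field_simp

lemma memWiener_density (k : ℕ) (F : ℝ → ℂ) (hm : Measurable F) (h0 : Integrable F)
    (h1 : Integrable (fun ξ : ℝ => (Complex.I * ξ) ^ k * F ξ)) :
    memWiener k (fun l : ℝ => ∫ ξ : ℝ, Complex.exp (Complex.I * l * ξ) * F ξ) := by
  classical
  refine ⟨volume.withDensity (fun ξ => (‖F ξ‖₊ : ℝ≥0∞)), fun ξ => if F ξ = 0 then 1 else F ξ / ‖F ξ‖,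
    ?_, ?_, ?_, ?_, ?_⟩
  · exact isFiniteMeasure_withDensity h0.2.ne
  · exact Measurable.ite (hm (measurableSet_singleton 0)) measurable_const
      (hm.div (Complex.measurable_ofReal.comp hm.norm))
  · intro ξ
    dsimp only
    split_ifs with h
    · simp
    · simp [h]
  · rw [lintegral_withDensity_eq_lintegral_mul _ (by fun_prop) (by fun_prop)]
    refine ne_of_eq_of_ne (lintegral_congr fun ξ => ?_) h1.2.ne
    simp [enorm_mul, mul_comm, enorm_eq_nnnorm]
  · intro l
    rw [integral_withDensity_eq_integral_smul (by fun_prop)]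
    refine integral_congr_ae (Eventually.of_forall fun ξ => ?_)
    beta_reduce
    rw [NNReal.smul_def, Complex.real_smul]
    split_ifs with h
    · simp [h]
    · have : (‖F ξ‖ : ℂ) ≠ 0 := by simpa using h
      simp only [coe_nnnorm]
      field_simp

lemma fourierNC_continuous (f : ℝ → ℂ) (hf : Integrable f) : Continuous (fourierNC f) := by
  unfold fourierNC
  refine continuous_of_dominated (bound := fun ξ => ‖f ξ‖) ?_ ?_ hf.norm ?_
  · exact fun y => (by fun_prop : Continuous
      (fun ξ : ℝ => Complex.exp (-(Complex.I * ξ * y)))).aestronglyMeasurable.mul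
        hf.aestronglyMeasurable
  · exact fun y => Eventually.of_forall fun ξ => by rw [norm_mul, norm_e', one_mul]
  · exact Eventually.of_forall fun ξ => by fun_prop

lemma schwartz_nc (φ : SchwartzMap ℝ ℂ) (n : ℕ) :
    Integrable (fun ξ : ℝ => (Complex.I * ξ) ^ n * fourierNC φ ξ) := by
  have h1 := (𝓕 φ).integrable_pow_mul volume n
  have h2 := (h1.comp_div (R := 2 * Real.pi) (by positivity)).const_mul ((2 * Real.pi) ^ n)
  refine h2.mono' ?_ (Eventually.of_forall fun ξ => le_of_eq ?_)
  · exact (by fun_prop : Continuous (fun ξ : ℝ => (Complex.I * ξ) ^ n)).aestronglyMeasurable.mul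
      (fourierNC_continuous _ φ.integrable).aestronglyMeasurable
  · rw [fourierNC_eq, ← SchwartzMap.fourier_coe, norm_mul, norm_pow, norm_mul, Complex.norm_I,
      one_mul, Complex.norm_real, norm_div, Real.norm_eq_abs (2 * Real.pi),
      abs_of_pos (by positivity : 0 < 2 * Real.pi), div_pow]
    field_simp

lemma bwd (g : ℝ → ℂ) (hgc : Continuous g) (hgs : HasCompactSupport g)
    (k : ℕ) (h : ℝ → ℂ) (hh : ContDiff ℝ (k : ℕ∞) h)
    (hder : iteratedDeriv k h = g) (hg : Integrable (fourierNC g) volume) (r : ℝ) (hr : 0 < r) :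
    ∃ f : ℝ → ℂ, memWiener k f ∧ Set.EqOn f h (Set.Icc (-r) r) := by
  have hgi : Integrable g := hgc.integrable_of_hasCompactSupport hgs
  set G : ℝ → ℂ := fun ξ => (2 * Real.pi : ℂ)⁻¹ * fourierNC g ξ with hG
  have hGc : Continuous G := continuous_const.mul (fourierNC_continuous g hgi)
  have hGi : Integrable G := hg.const_mul _
  set A : Set ℝ := {ξ | 1 < |ξ|} with hA
  have hAm : MeasurableSet A := (isOpen_lt continuous_const continuous_abs).measurableSet
  set Fhi : ℝ → ℂ := A.indicator (fun ξ => ((Complex.I * ξ) ^ k)⁻¹ * G ξ) with hFhi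
  set Flo : ℝ → ℂ := Aᶜ.indicator G with hFlo
  have mhi : Measurable Fhi := by
    refine Measurable.indicator ?_ hAm
    have := hGc.measurable
    fun_prop
  have mlo : Measurable Flo := hGc.measurable.indicator hAm.compl
  have mp : ∀ j : ℕ, Measurable (fun ξ : ℝ => (Complex.I * (ξ : ℂ)) ^ j) := fun j => by fun_prop
  have np : ∀ (ξ : ℝ) (j : ℕ), ‖(Complex.I * (ξ : ℂ)) ^ j‖ = |ξ| ^ j := fun ξ j => by
    simp
  have ihi : ∀ j ≤ k, Integrable (fun ξ : ℝ => (Complex.I * ξ) ^ j * Fhi ξ) := by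
    intro j hj
    refine hGi.norm.mono' ((mp j).mul mhi).aestronglyMeasurable
      (Eventually.of_forall fun ξ => ?_)
    by_cases hξ : ξ ∈ A
    · rw [hFhi, Set.indicator_of_mem hξ, norm_mul, norm_mul, norm_inv, np, np, ← mul_assoc]
      have h1 : 1 < |ξ| := hξ
      have h2 : |ξ| ^ j ≤ |ξ| ^ k := pow_le_pow_right₀ h1.le hj
      have h3 : |ξ| ^ j * (|ξ| ^ k)⁻¹ ≤ 1 := by
        rw [← div_eq_mul_inv]
        exact (div_le_one (by positivity)).2 h2
      exact mul_le_of_le_one_left (norm_nonneg _) h3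
    · rw [hFhi, Set.indicator_of_notMem hξ]; simp
  have ilo : ∀ j : ℕ, Integrable (fun ξ : ℝ => (Complex.I * ξ) ^ j * Flo ξ) := by
    intro j
    refine hGi.norm.mono' ((mp j).mul mlo).aestronglyMeasurable
      (Eventually.of_forall fun ξ => ?_)
    by_cases hξ : ξ ∈ A
    · rw [hFlo, Set.indicator_of_notMem (by simpa using hξ)]; simp
    · rw [hFlo, Set.indicator_of_mem (by simpa using hξ), norm_mul, np]
      have h1 : |ξ| ≤ 1 := not_lt.1 hξ
      exact mul_le_of_le_one_left (norm_nonneg _) (pow_le_one₀ (abs_nonneg _) h1)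
  have ie : ∀ (F : ℝ → ℂ) (l : ℝ), Integrable F →
      Integrable (fun ξ : ℝ => Complex.exp (Complex.I * l * ξ) * F ξ) := fun F l hF =>
    hF.bdd_mul (c := 1) (by fun_prop : Continuous
      (fun ξ : ℝ => Complex.exp (Complex.I * l * ξ))).aestronglyMeasurable
      (Eventually.of_forall fun ξ => (norm_e l ξ).le)
  obtain ⟨H1, H2⟩ := fint_deriv k volume Fhi ihi
  set H : ℝ → ℂ := fun l : ℝ => ∫ ξ : ℝ, Complex.exp (Complex.I * l * ξ) * Fhi ξ with hH
  set u : ℝ → ℂ := h - H with hu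
  have hu1 : ContDiff ℝ (k : ℕ∞) u := hh.sub H1
  have hu2 : iteratedDeriv k u = fun l : ℝ => ∫ ξ : ℝ, Complex.exp (Complex.I * l * ξ) * Flo ξ := by
    funext l
    rw [hu, iteratedDeriv_sub hh.contDiffAt H1.contDiffAt, hder, H2, inversion g hgc hgi hg l]
    rw [← integral_sub (ie _ l hGi) (ie _ l (ihi k le_rfl))]
    refine integral_congr_ae (Eventually.of_forall fun ξ => ?_)
    beta_reduce
    by_cases hξ : ξ ∈ A
    · have hξ' : ξ ∉ Aᶜ := fun hc => hc hξ
      rw [hFlo, hFhi, Set.indicator_of_notMem hξ', Set.indicator_of_mem hξ]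
      have h1 : 1 < |ξ| := hξ
      have h2 : (Complex.I * (ξ : ℂ)) ^ k ≠ 0 := by
        rw [← norm_ne_zero_iff, np]; positivity
      rw [mul_inv_cancel_left₀ h2, sub_self, mul_zero]
    · have hξ' : ξ ∈ Aᶜ := hξ
      rw [hFlo, hFhi, Set.indicator_of_mem hξ', Set.indicator_of_notMem hξ]
      simp [hG]
  have hu3 : ContDiff ℝ ∞ u := by
    refine smooth_of_iter k u hu1 ?_
    rw [hu2]
    exact contDiff_infty.2 fun n => (fint_deriv n volume Flo (fun j _ => ilo j)).1
  let χ : ContDiffBump (0 : ℝ) := ⟨r, r + 1, hr, by linarith⟩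
  have hφ1 : HasCompactSupport (fun x : ℝ => ((χ x : ℝ) : ℂ) * u x) :=
    (χ.hasCompactSupport.comp_left (g := fun x : ℝ => (x : ℂ)) (by simp)).mul_right
  have hφ2 : ContDiff ℝ ∞ (fun x : ℝ => ((χ x : ℝ) : ℂ) * u x) :=
    (Complex.ofRealCLM.contDiff.comp χ.contDiff).mul hu3
  let φ : SchwartzMap ℝ ℂ := hφ1.toSchwartzMap hφ2
  have hφ : ∀ x, φ x = ((χ x : ℝ) : ℂ) * u x := fun x => rfl
  set S : ℝ → ℂ := fun ξ => (2 * Real.pi : ℂ)⁻¹ * fourierNC φ ξ with hS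
  have iS : ∀ j : ℕ, Integrable (fun ξ : ℝ => (Complex.I * ξ) ^ j * S ξ) := fun j => by
    refine ((schwartz_nc φ j).const_mul (2 * Real.pi : ℂ)⁻¹).congr
      (Eventually.of_forall fun ξ => ?_)
    simp only [hS]; ring
  have iS0 : Integrable S := by simpa using iS 0
  have iF0 : Integrable Fhi := by simpa using ihi 0 (Nat.zero_le _)
  have inc : Integrable (fourierNC φ) := by simpa using schwartz_nc φ 0
  have mS : Measurable S :=
    (continuous_const.mul (fourierNC_continuous φ φ.integrable)).measurable
  refine ⟨fun l : ℝ => ∫ ξ : ℝ, Complex.exp (Complex.I * l * ξ) * (Fhi ξ + S ξ),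
    memWiener_density k (fun ξ => Fhi ξ + S ξ) (mhi.add mS) (iF0.add iS0) ?_, ?_⟩
  · refine ((ihi k le_rfl).add (iS k)).congr (Eventually.of_forall fun ξ => ?_)
    simp [mul_add]
  · intro l hl
    beta_reduce
    simp only [mul_add]
    rw [integral_add (ie _ l iF0) (ie _ l iS0), ← inversion φ φ.continuous φ.integrable inc l, hφ]
    have : χ l = 1 := χ.one_of_mem_closedBall (by
      simpa [Real.closedBall_eq_Icc] using hl)
    rw [this, hu]
    simp [hH]

lemma fwd (g : ℝ → ℂ) (hgs : HasCompactSupport g)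
    (k : ℕ) (h : ℝ → ℂ)
    (hder : iteratedDeriv k h = g)
    (hW : ∀ r : ℝ, 0 < r → ∃ f : ℝ → ℂ, memWiener k f ∧ Set.EqOn f h (Set.Icc (-r) r)) :
    Integrable (fourierNC g) volume := by
  obtain ⟨R, hR, hsub⟩ := hgs.isCompact.isBounded.subset_closedBall_lt 0 (0 : ℝ)
  obtain ⟨f, ⟨ν, m, hν, hm, hm1, hk, hf⟩, hfh⟩ := hW (R + 1) (by linarith)
  have np : ∀ (ξ : ℝ) (j : ℕ), ‖(Complex.I * (ξ : ℂ)) ^ j‖ = |ξ| ^ j := fun ξ j => by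
    simp
  have hki : Integrable (fun ξ : ℝ => |ξ| ^ k) ν := by
    refine ⟨(by fun_prop : Continuous (fun ξ : ℝ => |ξ| ^ k)).aestronglyMeasurable, ?_⟩
    refine lt_of_le_of_lt (le_of_eq ?_) (lt_top_iff_ne_top.2 hk)
    refine lintegral_congr fun ξ => ?_
    rw [enorm_pow, ← Real.norm_eq_abs, enorm_norm]; rfl
  have hint : ∀ j ≤ k, Integrable (fun ξ : ℝ => (Complex.I * ξ) ^ j * m ξ) ν := by
    intro j hj
    refine ((integrable_const (1 : ℝ)).add hki).mono' (by fun_prop) (Eventually.of_forall fun ξ => ?_)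
    rw [norm_mul, np, hm1, mul_one]
    simp only [Pi.add_apply]
    rcases le_total |ξ| 1 with h1 | h1
    · have := pow_le_one₀ (n := j) (abs_nonneg ξ) h1
      have : 0 ≤ |ξ| ^ k := by positivity
      linarith
    · have := pow_le_pow_right₀ h1 hj
      linarith
  have hf' : f = fun l : ℝ => ∫ ξ : ℝ, Complex.exp (Complex.I * l * ξ) * m ξ ∂ν := funext hf
  have hD := (fint_deriv k ν m hint).2
  rw [← hf'] at hD
  let χ : ContDiffBump (0 : ℝ) := ⟨R, R + 1, hR, by linarith⟩
  have hφ1 : HasCompactSupport (fun x : ℝ => ((χ x : ℝ) : ℂ)) :=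
    (χ.hasCompactSupport.comp_left (g := fun x : ℝ => (x : ℂ)) (by simp))
  have hφ2 : ContDiff ℝ ∞ (fun x : ℝ => ((χ x : ℝ) : ℂ)) :=
    (Complex.ofRealCLM.contDiff.comp χ.contDiff)
  let φ : SchwartzMap ℝ ℂ := hφ1.toSchwartzMap hφ2
  have hφ : ∀ x, φ x = ((χ x : ℝ) : ℂ) := fun x => rfl
  set M : ℝ → ℂ := fun ξ : ℝ => (Complex.I * ξ) ^ k * m ξ with hM
  have hMi : Integrable M ν := hint k le_rfl
  have hg : ∀ x, g x = φ x * ∫ ξ, Complex.exp (Complex.I * x * ξ) * M ξ ∂ν := by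
    intro x
    rw [hφ, ← congrFun hD x]
    by_cases hx : |x| < R + 1
    · have e : f =ᶠ[𝓝 x] h := by
        have : Set.Icc (-(R+1)) (R+1) ∈ 𝓝 x := Icc_mem_nhds (abs_lt.1 hx).1 (abs_lt.1 hx).2
        exact hfh.eventuallyEq_of_mem this
      rw [e.iteratedDeriv_eq k, hder]
      by_cases hx2 : |x| ≤ R
      · have : χ x = 1 := χ.one_of_mem_closedBall (by simpa using hx2)
        simp [this]
      · have : g x = 0 := by
          by_contra hne
          exact hx2 (by simpa using hsub (subset_tsupport g hne))
        simp [this]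
    · have h0 : χ x = 0 := χ.zero_of_le_dist (by simpa using not_lt.1 hx)
      have : g x = 0 := by
        by_contra hne
        have : |x| ≤ R := by simpa using hsub (subset_tsupport g hne)
        linarith
      simp [this, h0]
  have inc : Integrable (fourierNC φ) := by simpa using schwartz_nc φ 0
  have hconv := (hMi.convolution_integrand (μ := volume) (ContinuousLinearMap.mul ℝ ℂ) inc).integral_prod_left
  refine hconv.congr (Eventually.of_forall fun η => ?_)
  simp only [ContinuousLinearMap.mul_apply']
  have e1 : fourierNC g η = ∫ x : ℝ, ∫ ξ, Complex.exp (-(Complex.I * x * (η - ξ : ℝ))) * φ x * M ξ ∂ν := by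
    rw [fourierNC]
    refine integral_congr_ae (Eventually.of_forall fun x => ?_)
    beta_reduce
    rw [hg, ← integral_const_mul, ← integral_const_mul]
    refine integral_congr_ae (Eventually.of_forall fun ξ => ?_)
    beta_reduce
    have : -(Complex.I * x * (η - ξ : ℝ)) = -(Complex.I * x * η) + Complex.I * x * ξ := by
      push_cast; ring
    rw [this, Complex.exp_add]
    ring
  rw [e1, integral_integral_swap]
  · refine integral_congr_ae (Eventually.of_forall fun ξ => ?_)
    beta_reduce
    rw [integral_mul_const, mul_comm]
    rfl
  · have := (φ.integrable (μ := volume)).mul_prod hMi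
    refine (this.bdd_mul (c := 1) (f := fun p : ℝ × ℝ => Complex.exp (-(Complex.I * p.1 * (η - p.2 : ℝ))))
      (by fun_prop : Continuous _).aestronglyMeasurable
      (Eventually.of_forall fun p => (norm_e' _ _).le)).congr (Eventually.of_forall fun p => ?_)
    simp [Function.uncurry, mul_assoc]

/-- Lemma 4.3: if `g ∈ C_c(ℝ)`, `k ∈ ℕ`, `h ∈ C^k(ℝ)` and `h^{(k)} = g`,
then `h ∈ W_k(ℝ)_loc ↔ ĝ ∈ L^1(ℝ)`. -/
theorem stmt_18 (g : ℝ → ℂ) (hgc : Continuous g) (hgs : HasCompactSupport g)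
    (k : ℕ) (hk : 1 ≤ k) (h : ℝ → ℂ) (hh : ContDiff ℝ (k : ℕ∞) h)
    (hder : iteratedDeriv k h = g) :
    (∀ r : ℝ, 0 < r → ∃ f : ℝ → ℂ, memWiener k f ∧ Set.EqOn f h (Set.Icc (-r) r)) ↔
      Integrable (fourierNC g) volume := by
  exact ⟨fun hW => fwd g hgs k h hder hW, fun hg r hr => bwd g hgc hgs k h hh hder hg r hr⟩
end

section
/- Let ψ ∈ C_c^∞(ℝ) satisfy ψ ≡ 1 on [-1,1] and supp ψ ⊆ [-2,2], and define κ(x) := 1_{(0,∞)}(x) ψ(x) √x e^{-i/x} for x ∈ ℝ. Then the Fourier transform of κ satisfies κ̂(ξ) = √π · e^{-i(2√ξ + π/4)} · ξ^{-1} + O(ξ^{-3/2}) as ξ → ∞; in particular, κ̂ ∉ L^1(ℝ). -/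
open MeasureTheory Filter Asymptotics
open scoped ENNReal NNReal

noncomputable def Ph (b : ℂ) (s : ℝ) : ℂ := ∫ t in (0:ℝ)..s, Complex.exp (-b * (t:ℂ)^2)

lemma Ph_hasDerivAt (b : ℂ) (s : ℝ) : HasDerivAt (Ph b) (Complex.exp (-b * (s:ℂ)^2)) s := by
  have hc : Continuous fun t : ℝ => Complex.exp (-b * (t:ℂ)^2) := by fun_prop
  exact intervalIntegral.integral_hasDerivAt_right (hc.intervalIntegrable _ _)
    (hc.stronglyMeasurableAtFilter _ _) hc.continuousAt

lemma norm_exp_le (b : ℂ) (hb : 0 ≤ b.re) (t : ℝ) : ‖Complex.exp (-b * (t:ℂ)^2)‖ ≤ 1 := by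
  rw [Complex.norm_exp, Real.exp_le_one_iff]
  have : (-b * (t:ℂ)^2).re = -(b.re * t^2) := by
    rw [← Complex.ofReal_pow, Complex.re_mul_ofReal]; simp
  rw [this]
  have := mul_nonneg hb (sq_nonneg t)
  linarith

lemma Ph_tail (b : ℂ) (hb : 0 ≤ b.re) (hb0 : b ≠ 0) (s T : ℝ) (hs : 0 < s) (hT : s ≤ T) :
    ‖Ph b T - Ph b s‖ ≤ 1 / (‖b‖ * s) := by
  have hc : Continuous fun t : ℝ => Complex.exp (-b * (t:ℂ)^2) := by fun_prop
  have hbn : 0 < ‖b‖ := norm_pos_iff.mpr hb0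
  have hTp : 0 < T := hs.trans_le hT
  have hd : ∀ t ∈ Set.uIcc s T, HasDerivAt
      (fun t : ℝ => Ph b t + Complex.exp (-b * (t:ℂ)^2) / (2 * b * t) )
      (- (Complex.exp (-b * (t:ℂ)^2) / (2 * b * t^2))) t := by
    intro t ht
    rw [Set.uIcc_of_le hT] at ht
    have ht0 : (t:ℂ) ≠ 0 := by
      have : t ≠ 0 := (hs.trans_le ht.1).ne'
      exact_mod_cast this
    have h1 : HasDerivAt (fun t : ℝ => (t:ℂ)) 1 t := Complex.ofRealCLM.hasDerivAt
    have h2 := (((h1.pow 2).const_mul (-b)).cexp).div (h1.const_mul (2*b)) (by simp [hb0, ht0])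
    refine ((Ph_hasDerivAt b t).add h2).congr_deriv ?_
    simp only [Pi.pow_apply]
    field_simp
    push_cast
    ring
  have hcont : ContinuousOn (fun t : ℝ => - (Complex.exp (-b * (t:ℂ)^2) / (2 * b * t^2)))
      (Set.uIcc s T) := by
    apply ContinuousOn.neg
    apply ContinuousOn.div hc.continuousOn (by fun_prop)
    intro t ht
    rw [Set.uIcc_of_le hT] at ht
    have : t ≠ 0 := (hs.trans_le ht.1).ne'
    simp [hb0, this]
  have hI := intervalIntegral.integral_eq_sub_of_hasDerivAt hd hcont.intervalIntegrable
  have hd2 : ∀ t ∈ Set.uIcc s T, HasDerivAt (fun t : ℝ => - (1 / (2 * ‖b‖)) * t⁻¹)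
      (1 / (2 * ‖b‖ * t^2)) t := by
    intro t ht
    rw [Set.uIcc_of_le hT] at ht
    have : t ≠ 0 := (hs.trans_le ht.1).ne'
    refine ((hasDerivAt_inv this).const_mul _).congr_deriv ?_
    field_simp
  have hcont2 : ContinuousOn (fun t : ℝ => (1 / (2 * ‖b‖ * t^2))) (Set.uIcc s T) := by
    apply ContinuousOn.div (by fun_prop) (by fun_prop)
    intro t ht
    rw [Set.uIcc_of_le hT] at ht
    have : t ≠ 0 := (hs.trans_le ht.1).ne'
    simp [hb0, this]
  have hI2 := intervalIntegral.integral_eq_sub_of_hasDerivAt hd2 hcont2.intervalIntegrable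
  have hle : ‖∫ t in s..T, - (Complex.exp (-b * (t:ℂ)^2) / (2 * b * t^2))‖ ≤
      ∫ t in s..T, 1 / (2 * ‖b‖ * t^2) := by
    apply intervalIntegral.norm_integral_le_of_norm_le hT _ hcont2.intervalIntegrable
    refine Filter.Eventually.of_forall fun t ht => ?_
    have htp : 0 < t := hs.trans ht.1
    rw [norm_neg, norm_div]
    have : ‖2 * b * (t:ℂ)^2‖ = 2 * ‖b‖ * t^2 := by simp
    rw [this]
    gcongr
    exact norm_exp_le b hb t
  have hb1 : ∀ t : ℝ, 0 < t → ‖Complex.exp (-b * (t:ℂ)^2) / (2 * b * t)‖ ≤ 1 / (2 * ‖b‖ * t) := by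
    intro t ht
    rw [norm_div]
    have : ‖2 * b * (t:ℂ)‖ = 2 * ‖b‖ * t := by simp [abs_of_pos ht]
    rw [this]
    gcongr
    exact norm_exp_le b hb t
  have hs1 := hb1 s hs
  have hT1 := hb1 T hTp
  rw [hI2, hI] at hle
  have key : Ph b T - Ph b s = (Ph b T + Complex.exp (-b * (T:ℂ)^2) / (2 * b * T)
      - (Ph b s + Complex.exp (-b * (s:ℂ)^2) / (2 * b * s)))
      - Complex.exp (-b * (T:ℂ)^2) / (2 * b * T) + Complex.exp (-b * (s:ℂ)^2) / (2 * b * s) := by ring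
  rw [key]
  refine (norm_add_le _ _).trans ?_
  refine (add_le_add_left (norm_sub_le _ _) _).trans ?_
  have e1 : 1 / (2 * ‖b‖ * T) = 1 / (2 * ‖b‖) * T⁻¹ := by field_simp
  have e2 : 1 / (2 * ‖b‖ * s) = 1 / (2 * ‖b‖) * s⁻¹ := by field_simp
  have e3 : 1 / (‖b‖ * s) = 2 * (1 / (2 * ‖b‖) * s⁻¹) := by field_simp
  rw [e1] at hT1
  rw [e2] at hs1
  rw [e3]
  linarith

lemma Ph_gauss (b : ℂ) (hb : 0 < b.re) (s : ℝ) (hs : 0 < s) :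
    ‖(Real.pi / b) ^ (1/2 : ℂ) / 2 - Ph b s‖ ≤ 1 / (‖b‖ * s) := by
  have hb0 : b ≠ 0 := by rintro rfl; simp at hb
  have h1 : Tendsto (fun T => Ph b T) atTop (nhds ((Real.pi / b) ^ (1/2 : ℂ) / 2)) := by
    rw [← integral_gaussian_complex_Ioi hb]
    exact intervalIntegral_tendsto_integral_Ioi 0
      (integrable_cexp_neg_mul_sq hb).integrableOn tendsto_id
  refine le_of_tendsto (h1.sub_const _).norm ?_
  filter_upwards [eventually_ge_atTop s] with T hT
  exact Ph_tail b hb.le hb0 s T hs hT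

noncomputable def cF : ℂ := (Real.sqrt Real.pi : ℂ) * Complex.exp (-(Complex.I * (Real.pi / 4))) / 2

lemma cF_eq : (Real.pi / Complex.I) ^ (1/2 : ℂ) / 2 = cF := by
  unfold cF
  have h0 : (Real.pi / Complex.I : ℂ) ≠ 0 := by simp [Real.pi_ne_zero]
  rw [Complex.cpow_def_of_ne_zero h0]
  have h1 : (Real.pi / Complex.I : ℂ) = (Real.pi : ℂ) * (-Complex.I) := by
    rw [div_eq_mul_inv, Complex.inv_I]
  rw [h1, Complex.log_ofReal_mul Real.pi_pos (by simp), Complex.log_neg_I]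
  rw [Real.sqrt_eq_rpow, Real.rpow_def_of_pos Real.pi_pos]
  push_cast
  rw [← Complex.exp_add]
  congr 2
  ring

lemma Ph_I (s : ℝ) (hs : 0 < s) : ‖Ph Complex.I s - cF‖ ≤ 1 / s := by
  have ht : Tendsto (fun ε : ℝ => (ε : ℂ) + Complex.I) (nhdsWithin 0 (Set.Ioi 0)) (nhds Complex.I) := by
    have : Continuous (fun ε : ℝ => (ε : ℂ) + Complex.I) := by fun_prop
    have := this.tendsto 0
    simp only [Complex.ofReal_zero, zero_add] at this
    exact this.mono_left nhdsWithin_le_nhds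
  have hPh : Continuous (fun b : ℂ => Ph b s) := by
    unfold Ph
    apply intervalIntegral.continuous_parametric_intervalIntegral_of_continuous'
    fun_prop
  have h2 : ContinuousAt (fun b : ℂ => (Real.pi / b) ^ (1/2 : ℂ) / 2) Complex.I := by
    have : ContinuousAt (fun b : ℂ => (Real.pi / b : ℂ)) Complex.I :=
      continuousAt_const.div continuousAt_id (by simp)
    refine (this.cpow continuousAt_const ?_).div_const _
    right
    simp [div_eq_mul_inv, Real.pi_ne_zero]
  have h3 : ContinuousAt (fun b : ℂ => 1 / (‖b‖ * s)) Complex.I := by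
    apply ContinuousAt.div continuousAt_const (by fun_prop)
    simp [hs.ne']
  have h4 := le_of_tendsto_of_tendsto (((h2.sub hPh.continuousAt).norm).tendsto.comp ht)
    (h3.tendsto.comp ht) (by
      filter_upwards [self_mem_nhdsWithin] with ε hε
      exact Ph_gauss _ (by simpa using hε) s hs)
  simp only [Complex.norm_I, one_mul] at h4
  rw [norm_sub_rev, ← cF_eq]
  exact h4

lemma Ph_neg (b : ℂ) (s : ℝ) : Ph b (-s) = - Ph b s := by
  unfold Ph
  have := intervalIntegral.integral_comp_neg (a := 0) (b := s)
    (fun t : ℝ => Complex.exp (-b * (t:ℂ)^2))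
  simp only [Complex.ofReal_neg, neg_sq, neg_zero] at this
  rw [this, intervalIntegral.integral_symm]

lemma Ph_tendsto_atTop : Tendsto (fun s => Ph Complex.I s - cF) atTop (nhds 0) := by
  have h : Tendsto (fun s : ℝ => 1 / s) atTop (nhds 0) := by
    simpa using tendsto_inv_atTop_zero (𝕜 := ℝ)
  refine squeeze_zero_norm' ?_ h
  filter_upwards [eventually_gt_atTop 0] with s hs using Ph_I s hs

lemma Ph_tendsto_atBot : Tendsto (fun s => Ph Complex.I s + cF) atBot (nhds 0) := by
  have h := (Ph_tendsto_atTop.comp tendsto_neg_atBot_atTop).neg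
  rw [neg_zero] at h
  refine h.congr fun s => ?_
  simp only [Function.comp, Ph_neg]
  ring

noncomputable def EE (a x : ℝ) : ℂ := Complex.exp (-(Complex.I * ((a:ℂ)^2 * x + 1 / x)))

lemma norm_EE (a x : ℝ) : ‖EE a x‖ = 1 := by
  unfold EE
  have : (-(Complex.I * ((a:ℂ)^2 * x + 1 / x))) = ((-(a^2*x+1/x) : ℝ) : ℂ) * Complex.I := by
    push_cast; ring
  rw [this, Complex.norm_exp_ofReal_mul_I]

noncomputable def AA (a x : ℝ) : ℂ :=
  Complex.exp (-(Complex.I * (2 * a))) * (Ph Complex.I (a * (Real.sqrt x) - 1 / (Real.sqrt x)) + cF)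
noncomputable def BB (a x : ℝ) : ℂ :=
  Complex.exp (Complex.I * (2 * a)) * (Ph Complex.I (a * (Real.sqrt x) + 1 / (Real.sqrt x)) - cF)

noncomputable def VV (a x : ℝ) : ℂ :=
  1 / (a:ℂ)^2 * (AA a x - BB a x) + 1 / (2 * Complex.I * (a:ℂ)^3) * (AA a x + BB a x)
    - ((Real.sqrt x) : ℂ) * EE a x / (Complex.I * (a:ℂ)^2)

lemma inv_sqrt_deriv (x : ℝ) (hx : 0 < x) :
    HasDerivAt (fun x : ℝ => 1 / (Real.sqrt x)) (-(1 / (2 * (Real.sqrt x) * x))) x := by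
  have hs : 0 < (Real.sqrt x) := Real.sqrt_pos.mpr hx
  have h := (Real.hasDerivAt_sqrt hx.ne').inv hs.ne'
  simp only [one_div]
  refine h.congr_deriv ?_
  rw [Real.sq_sqrt hx.le]
  field_simp

lemma AA_deriv (a x : ℝ) (hx : 0 < x) :
    HasDerivAt (AA a) (((a / (2 * (Real.sqrt x)) + 1 / (2 * (Real.sqrt x) * x) : ℝ) : ℂ) * EE a x) x := by
  have hs : 0 < (Real.sqrt x) := Real.sqrt_pos.mpr hx
  have hu : HasDerivAt (fun x : ℝ => a * (Real.sqrt x) - 1 / (Real.sqrt x)) (a / (2 * (Real.sqrt x)) + 1 / (2 * (Real.sqrt x) * x)) x := by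
    refine (((Real.hasDerivAt_sqrt hx.ne').const_mul a).sub (inv_sqrt_deriv x hx)).congr_deriv ?_
    ring
  have h := (HasDerivAt.scomp x (Ph_hasDerivAt Complex.I (a * (Real.sqrt x) - 1 / (Real.sqrt x))) hu)
  refine ((h.add_const cF).const_mul (Complex.exp (-(Complex.I * (2 * a))))).congr_deriv ?_
  rw [Complex.real_smul, mul_left_comm, ← Complex.exp_add]
  congr 2
  have e : (a * (Real.sqrt x) - 1 / (Real.sqrt x))^2 = a^2 * x + 1 / x - 2 * a := by
    have : (Real.sqrt x) ^ 2 = x := Real.sq_sqrt hx.le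
    have h2 : (1 / (Real.sqrt x)) ^ 2 = 1 / x := by rw [div_pow, this, one_pow]
    have h3 : (Real.sqrt x) * (1 / (Real.sqrt x)) = 1 := by field_simp
    linear_combination a^2 * this + h2 - 2 * a * h3
  rw [← Complex.ofReal_pow, e]
  push_cast
  ring

lemma BB_deriv (a x : ℝ) (hx : 0 < x) :
    HasDerivAt (BB a) (((a / (2 * (Real.sqrt x)) - 1 / (2 * (Real.sqrt x) * x) : ℝ) : ℂ) * EE a x) x := by
  have hs : 0 < (Real.sqrt x) := Real.sqrt_pos.mpr hx
  have hu : HasDerivAt (fun x : ℝ => a * (Real.sqrt x) + 1 / (Real.sqrt x)) (a / (2 * (Real.sqrt x)) - 1 / (2 * (Real.sqrt x) * x)) x := by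
    refine (((Real.hasDerivAt_sqrt hx.ne').const_mul a).add (inv_sqrt_deriv x hx)).congr_deriv ?_
    ring
  have h := (HasDerivAt.scomp x (Ph_hasDerivAt Complex.I (a * (Real.sqrt x) + 1 / (Real.sqrt x))) hu)
  refine ((h.sub_const cF).const_mul (Complex.exp (Complex.I * (2 * a)))).congr_deriv ?_
  rw [Complex.real_smul, mul_left_comm, ← Complex.exp_add]
  congr 2
  have e : (a * (Real.sqrt x) + 1 / (Real.sqrt x))^2 = a^2 * x + 1 / x + 2 * a := by
    have : (Real.sqrt x) ^ 2 = x := Real.sq_sqrt hx.le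
    have h2 : (1 / (Real.sqrt x)) ^ 2 = 1 / x := by rw [div_pow, this, one_pow]
    have h3 : (Real.sqrt x) * (1 / (Real.sqrt x)) = 1 := by field_simp
    linear_combination a^2 * this + h2 + 2 * a * h3
  rw [← Complex.ofReal_pow, e]
  push_cast
  ring

lemma EE_deriv (a x : ℝ) (hx : 0 < x) :
    HasDerivAt (EE a) (-(Complex.I * ((a:ℂ)^2 - 1 / (x:ℂ)^2)) * EE a x) x := by
  have hx0 : (x:ℂ) ≠ 0 := by exact_mod_cast hx.ne'
  have h1 : HasDerivAt (fun t : ℝ => (t:ℂ)) 1 x := Complex.ofRealCLM.hasDerivAt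
  have h2 := (((h1.const_mul ((a:ℂ)^2)).add (h1.inv hx0)).const_mul Complex.I).neg.cexp
  have h3 : HasDerivAt (EE a) _ x := h2.congr_of_eventuallyEq (by
    filter_upwards with t
    simp [EE])
  refine h3.congr_deriv ?_
  simp only [EE, Pi.neg_apply, Pi.add_apply, Pi.inv_apply, one_div]
  ring

lemma VV_deriv (a x : ℝ) (ha : 0 < a) (hx : 0 < x) :
    HasDerivAt (VV a) (((Real.sqrt x) : ℂ) * EE a x) x := by
  have hs : 0 < (Real.sqrt x) := Real.sqrt_pos.mpr hx
  have hA := AA_deriv a x hx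
  have hB := BB_deriv a x hx
  have hS := (Real.hasDerivAt_sqrt hx.ne').ofReal_comp
  have h := (((hA.sub hB).const_mul (1 / (a:ℂ)^2)).add
    ((hA.add hB).const_mul (1 / (2 * Complex.I * (a:ℂ)^3)))).sub
    ((hS.mul (EE_deriv a x hx)).div_const (Complex.I * (a:ℂ)^2))
  refine h.congr_deriv ?_
  have hx0 : (x:ℂ) ≠ 0 := by exact_mod_cast hx.ne'
  have ha0 : (a:ℂ) ≠ 0 := by exact_mod_cast ha.ne'
  have hs0 : ((Real.sqrt x):ℂ) ≠ 0 := by exact_mod_cast hs.ne'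
  have hsx : (x:ℂ) = ((Real.sqrt x):ℂ)^2 := by exact_mod_cast (Real.sq_sqrt hx.le).symm
  have hI := Complex.I_ne_zero
  push_cast
  generalize ((Real.sqrt x):ℂ) = s at *
  rw [hsx]
  field_simp
  ring_nf

lemma VV_tendsto (a : ℝ) (ha : 0 < a) : Tendsto (VV a) (nhdsWithin 0 (Set.Ioi 0)) (nhds 0) := by
  have hs0 : Tendsto (fun x : ℝ => (Real.sqrt x)) (nhdsWithin 0 (Set.Ioi 0)) (nhds 0) := by
    have := Real.continuous_sqrt.tendsto 0
    rw [Real.sqrt_zero] at this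
    exact this.mono_left nhdsWithin_le_nhds
  have hs : Tendsto (fun x : ℝ => (Real.sqrt x)) (nhdsWithin 0 (Set.Ioi 0)) (nhdsWithin 0 (Set.Ioi 0)) := by
    refine tendsto_nhdsWithin_iff.mpr ⟨hs0, ?_⟩
    filter_upwards [self_mem_nhdsWithin] with x hx using Real.sqrt_pos.mpr hx
  have hi : Tendsto (fun x : ℝ => 1 / (Real.sqrt x)) (nhdsWithin 0 (Set.Ioi 0)) atTop := by
    simp only [one_div]
    exact tendsto_inv_nhdsGT_zero.comp hs
  have has : Tendsto (fun x : ℝ => a * (Real.sqrt x)) (nhdsWithin 0 (Set.Ioi 0)) (nhds 0) := by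
    simpa using hs0.const_mul a
  have hu : Tendsto (fun x : ℝ => a * (Real.sqrt x) - 1 / (Real.sqrt x)) (nhdsWithin 0 (Set.Ioi 0)) atBot := by
    simp only [sub_eq_add_neg]
    exact has.add_atBot (tendsto_neg_atTop_atBot.comp hi)
  have hv : Tendsto (fun x : ℝ => a * (Real.sqrt x) + 1 / (Real.sqrt x)) (nhdsWithin 0 (Set.Ioi 0)) atTop := has.add_atTop hi
  have hA : Tendsto (AA a) (nhdsWithin 0 (Set.Ioi 0)) (nhds 0) := by
    have := (Ph_tendsto_atBot.comp hu).const_mul (Complex.exp (-(Complex.I * (2 * a))))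
    rw [mul_zero] at this
    exact this
  have hB : Tendsto (BB a) (nhdsWithin 0 (Set.Ioi 0)) (nhds 0) := by
    have := (Ph_tendsto_atTop.comp hv).const_mul (Complex.exp (Complex.I * (2 * a)))
    rw [mul_zero] at this
    exact this
  have hE : Tendsto (fun x : ℝ => ((Real.sqrt x) : ℂ) * EE a x) (nhdsWithin 0 (Set.Ioi 0)) (nhds 0) := by
    refine squeeze_zero_norm (a := fun x => (Real.sqrt x)) (fun x => ?_) hs0
    rw [norm_mul, norm_EE, Complex.norm_real, Real.norm_of_nonneg (Real.sqrt_nonneg x), mul_one]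
  have := (((hA.sub hB).const_mul (1 / (a:ℂ)^2)).add
    ((hA.add hB).const_mul (1 / (2 * Complex.I * (a:ℂ)^3)))).sub
    (hE.div_const (Complex.I * (a:ℂ)^2))
  rw [sub_zero, add_zero, mul_zero, mul_zero, add_zero, zero_div, sub_zero] at this
  exact this

lemma norm_cF : ‖cF‖ ≤ 1 := by
  unfold cF
  have : (-(Complex.I * (Real.pi / 4)) : ℂ) = ((-(Real.pi / 4) : ℝ) : ℂ) * Complex.I := by
    push_cast; ring
  rw [norm_div, norm_mul, this, Complex.norm_exp_ofReal_mul_I, Complex.norm_real,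
    Real.norm_of_nonneg (Real.sqrt_nonneg _)]
  have : Real.sqrt Real.pi ≤ 2 := by
    rw [Real.sqrt_le_left (by norm_num)]
    linarith [Real.pi_le_four]
  simp
  linarith

/-- main term -/
noncomputable def MM (a : ℝ) : ℂ := 1 / (a:ℂ)^2 * (Complex.exp (-(Complex.I * (2 * a))) * (2 * cF))

noncomputable def RR (a x : ℝ) : ℂ := VV a x - MM a + ((Real.sqrt x) : ℂ) * EE a x / (Complex.I * (a:ℂ)^2)

lemma RR_bound (a x : ℝ) (ha : 2 ≤ a) (hx : 1 ≤ x) : ‖RR a x‖ ≤ 6 / a^3 := by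
  have ha0 : 0 < a := by linarith
  have hs : 1 ≤ (Real.sqrt x) := Real.one_le_sqrt.mpr hx
  have h1 : 1 / (Real.sqrt x) ≤ 1 := by rw [div_le_one (by linarith)]; exact hs
  have h1' : 0 < 1 / (Real.sqrt x) := by positivity
  have hu : a / 2 ≤ a * (Real.sqrt x) - 1 / (Real.sqrt x) := by nlinarith
  have hv : a ≤ a * (Real.sqrt x) + 1 / (Real.sqrt x) := by nlinarith
  have hP : ‖Ph Complex.I (a * (Real.sqrt x) - 1 / (Real.sqrt x)) - cF‖ ≤ 2 / a := by
    refine (Ph_I _ (by linarith)).trans ?_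
    rw [show 2 / a = 1 / (a / 2) by field_simp]
    gcongr
  have hQ : ‖Ph Complex.I (a * (Real.sqrt x) + 1 / (Real.sqrt x)) - cF‖ ≤ 1 / a := by
    refine (Ph_I _ (by linarith)).trans ?_
    gcongr
  have hP2 : ‖Ph Complex.I (a * (Real.sqrt x) - 1 / (Real.sqrt x)) + cF‖ ≤ 3 := by
    rw [show Ph Complex.I (a * (Real.sqrt x) - 1 / (Real.sqrt x)) + cF = (Ph Complex.I (a * (Real.sqrt x) - 1 / (Real.sqrt x)) - cF)
      + cF + cF by ring]
    refine (norm_add₃_le).trans ?_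
    have : 2 / a ≤ 1 := by rw [div_le_one ha0]; exact ha
    linarith [norm_cF]
  have hQ2 : 1 / a ≤ 1 := by rw [div_le_one ha0]; linarith
  have e1 : ‖Complex.exp (-(Complex.I * (2 * a)))‖ = 1 := by
    have : (-(Complex.I * (2 * a)) : ℂ) = ((-(2 * a) : ℝ) : ℂ) * Complex.I := by
      push_cast; ring
    rw [this, Complex.norm_exp_ofReal_mul_I]
  have e2 : ‖Complex.exp (Complex.I * (2 * a))‖ = 1 := by
    have : (Complex.I * (2 * a) : ℂ) = ((2 * a : ℝ) : ℂ) * Complex.I := by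
      push_cast; ring
    rw [this, Complex.norm_exp_ofReal_mul_I]
  have hR : RR a x = 1 / (a:ℂ)^2 * (Complex.exp (-(Complex.I * (2 * a))) *
      (Ph Complex.I (a * (Real.sqrt x) - 1 / (Real.sqrt x)) - cF) - BB a x)
      + 1 / (2 * Complex.I * (a:ℂ)^3) * (AA a x + BB a x) := by
    simp only [RR, VV, MM, AA]
    ring
  have hA : ‖AA a x‖ ≤ 3 := by
    rw [AA, norm_mul, e1, one_mul]; exact hP2
  have hB : ‖BB a x‖ ≤ 1 / a := by
    rw [BB, norm_mul, e2, one_mul]; exact hQ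
  rw [hR]
  refine (norm_add_le _ _).trans ?_
  rw [norm_mul, norm_mul]
  have n1 : ‖1 / (a:ℂ)^2‖ = 1 / a^2 := by simp
  have n2 : ‖1 / (2 * Complex.I * (a:ℂ)^3)‖ = 1 / (2 * a^3) := by
    simp [abs_of_pos ha0]
  rw [n1, n2]
  have b1 : ‖Complex.exp (-(Complex.I * (2 * a))) *
      (Ph Complex.I (a * (Real.sqrt x) - 1 / (Real.sqrt x)) - cF) - BB a x‖ ≤ 3 / a := by
    refine (norm_sub_le _ _).trans ?_
    rw [norm_mul, e1, one_mul]
    refine (add_le_add hP hB).trans (le_of_eq ?_)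
    ring
  have b2 : ‖AA a x + BB a x‖ ≤ 4 := (norm_add_le _ _).trans (by linarith)
  calc _ ≤ 1 / a^2 * (3 / a) + 1 / (2 * a^3) * 4 := by gcongr
    _ = 5 / a^3 := by field_simp; norm_num
    _ ≤ 6 / a^3 := by gcongr; norm_num

lemma MM_norm (a : ℝ) : ‖MM a‖ ≤ 2 / a^2 := by
  have e1 : ‖Complex.exp (-(Complex.I * (2 * a)))‖ = 1 := by
    have : (-(Complex.I * (2 * a)) : ℂ) = ((-(2 * a) : ℝ) : ℂ) * Complex.I := by
      push_cast; ring
    rw [this, Complex.norm_exp_ofReal_mul_I]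
  rw [MM, norm_mul, norm_mul, e1, norm_mul, one_mul]
  have n1 : ‖1 / (a:ℂ)^2‖ = 1 / a^2 := by simp
  rw [n1]
  have := norm_cF
  calc _ ≤ 1 / a^2 * (‖(2:ℂ)‖ * 1) := by gcongr
    _ = _ := by simp; ring

lemma VV_bound (a x : ℝ) (ha : 2 ≤ a) (hx : 1 ≤ x) (hx2 : x ≤ 2) : ‖VV a x‖ ≤ 7 / a^2 := by
  have ha0 : 0 < a := by linarith
  have h : VV a x = RR a x + MM a + - (((Real.sqrt x) : ℂ) * EE a x / (Complex.I * (a:ℂ)^2)) := by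
    simp only [RR]; ring
  have hR : ‖RR a x‖ ≤ 3 / a^2 := by
    refine (RR_bound a x ha hx).trans ?_
    rw [show 3 / a^2 = 3 * a / a^3 by field_simp]
    gcongr
    linarith
  have hS : ‖((Real.sqrt x) : ℂ) * EE a x / (Complex.I * (a:ℂ)^2)‖ ≤ 2 / a^2 := by
    rw [norm_div, norm_mul, norm_EE, Complex.norm_real, Real.norm_of_nonneg (Real.sqrt_nonneg x)]
    have : ‖Complex.I * (a:ℂ)^2‖ = a^2 := by simp
    rw [this, mul_one]
    gcongr
    rw [Real.sqrt_le_left (by norm_num)]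
    linarith
  rw [h]
  refine norm_add₃_le.trans ?_
  rw [norm_neg]
  refine (add_le_add (add_le_add hR (MM_norm a)) hS).trans (le_of_eq ?_)
  ring

lemma sqrtEE_cont (a : ℝ) : ContinuousOn (fun x : ℝ => ((Real.sqrt x) : ℂ) * EE a x) (Set.Icc 1 2) := by
  intro x hx
  have hx0 : 0 < x := by linarith [hx.1]
  exact ((Complex.continuous_ofReal.comp Real.continuous_sqrt).continuousAt.mul
    (EE_deriv a x hx0).continuousAt).continuousWithinAt

lemma sqrtEE_int (a : ℝ) :
    IntervalIntegrable (fun x : ℝ => ((Real.sqrt x) : ℂ) * EE a x) volume 0 1 := by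
  have hm : Measurable (fun x : ℝ => ((Real.sqrt x) : ℂ) * EE a x) := by
    unfold EE
    fun_prop
  refine (intervalIntegrable_const (c := (1:ℝ))).mono_fun hm.aestronglyMeasurable ?_
  refine (ae_restrict_iff' measurableSet_uIoc).mpr (Filter.Eventually.of_forall fun x hx => ?_)
  rw [Set.uIoc_of_le zero_le_one] at hx
  beta_reduce
  rw [norm_mul, norm_EE, Complex.norm_real, Real.norm_of_nonneg (Real.sqrt_nonneg x)]
  simpa using hx.2

/-- Integration by parts against `VV` on `[1,2]`. -/
lemma parts (a : ℝ) (ha : 0 < a) (g : ℝ → ℝ) (hg : ContDiff ℝ 1 g) :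
    ∫ x in (1:ℝ)..2, (g x : ℂ) * (((Real.sqrt x) : ℂ) * EE a x) =
      g 2 * VV a 2 - g 1 * VV a 1 - ∫ x in (1:ℝ)..2, ((deriv g x : ℝ) : ℂ) * VV a x := by
  have h12 : Set.uIcc (1:ℝ) 2 = Set.Icc 1 2 := Set.uIcc_of_le (by norm_num)
  apply intervalIntegral.integral_mul_deriv_eq_deriv_mul
  · intro x _
    exact ((hg.differentiable (by norm_num)) x).hasDerivAt.ofReal_comp
  · intro x hx
    rw [h12] at hx
    exact VV_deriv a x ha (by linarith [hx.1])
  · exact (Complex.continuous_ofReal.comp (hg.continuous_deriv le_rfl)).intervalIntegrable _ _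
  · apply ContinuousOn.intervalIntegrable
    rw [h12]
    exact sqrtEE_cont a

lemma VV_cont (a : ℝ) (ha : 0 < a) : ContinuousOn (VV a) (Set.Icc 1 2) := fun x hx =>
  (VV_deriv a x ha (by linarith [hx.1])).continuousAt.continuousWithinAt

lemma bdd_on (g : ℝ → ℝ) (hg : Continuous g) : ∃ C, 0 ≤ C ∧ ∀ x ∈ Set.Icc (1:ℝ) 2, |g x| ≤ C := by
  obtain ⟨C, hC⟩ := isCompact_Icc.exists_bound_of_continuousOn (s := Set.Icc (1:ℝ) 2) hg.continuousOn
  exact ⟨C, (norm_nonneg _).trans (hC 1 (by norm_num)), hC⟩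

lemma main_bound (ψ : ℝ → ℝ) (hψ : ContDiff ℝ (⊤ : ℕ∞) ψ)
    (hψ1 : ∀ x ∈ Set.Icc (-1 : ℝ) 1, ψ x = 1) (hψ2 : ψ 2 = 0) :
    ∃ C, ∀ a : ℝ, 2 ≤ a →
      ‖(∫ x in (0:ℝ)..2, (ψ x : ℂ) * (((Real.sqrt x) : ℂ) * EE a x)) - MM a‖ ≤ C / a^3 := by
  have hψ' : ContDiff ℝ 1 (deriv ψ) := by
    have h2 : ContDiff ℝ (1 + 1) ψ := by
      rw [one_add_one_eq_two]
      exact_mod_cast contDiff_infty.mp hψ 2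
    exact (contDiff_succ_iff_deriv.mp h2).2.2
  have hψ1' : ContDiff ℝ 1 ψ := hψ.of_le (by exact_mod_cast le_top)
  obtain ⟨C1, hC1, hC1b⟩ := bdd_on (deriv ψ) hψ'.continuous
  obtain ⟨C2, hC2, hC2b⟩ := bdd_on (deriv (deriv ψ)) (hψ'.continuous_deriv le_rfl)
  have h12 : Set.uIcc (1:ℝ) 2 = Set.Icc 1 2 := Set.uIcc_of_le (by norm_num)
  refine ⟨6 * C1 + (14 * C1 + 7 * C2), fun a ha => ?_⟩
  have ha0 : 0 < a := by linarith
  have ha0' : (a:ℂ) ≠ 0 := by exact_mod_cast ha0.ne'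
  have hone : ψ 1 = 1 := hψ1 1 (by norm_num)
  have J1 : ∫ x in (0:ℝ)..1, (ψ x : ℂ) * (((Real.sqrt x) : ℂ) * EE a x) = VV a 1 := by
    have e : ∫ x in (0:ℝ)..1, (ψ x : ℂ) * (((Real.sqrt x) : ℂ) * EE a x) =
        ∫ x in (0:ℝ)..1, (((Real.sqrt x) : ℂ) * EE a x) := by
      apply intervalIntegral.integral_congr
      intro x hx
      rw [Set.uIcc_of_le zero_le_one] at hx
      simp only
      rw [hψ1 x ⟨by linarith [hx.1], hx.2⟩]
      simp
    rw [e, intervalIntegral.integral_eq_sub_of_hasDerivAt_of_tendsto zero_lt_one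
      (fun x hx => VV_deriv a x ha0 hx.1) (sqrtEE_int a) (VV_tendsto a ha0)
      ((VV_deriv a 1 ha0 one_pos).continuousAt.tendsto.mono_left nhdsWithin_le_nhds), sub_zero]
  have I1 : IntervalIntegrable (fun x => (ψ x : ℂ) * (((Real.sqrt x) : ℂ) * EE a x)) volume 0 1 :=
    (sqrtEE_int a).continuousOn_mul
      (Complex.continuous_ofReal.comp hψ1'.continuous).continuousOn
  have I2 : IntervalIntegrable (fun x => (ψ x : ℂ) * (((Real.sqrt x) : ℂ) * EE a x)) volume 1 2 := by
    apply ContinuousOn.intervalIntegrable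
    rw [h12]
    exact (Complex.continuous_ofReal.comp hψ1'.continuous).continuousOn.mul (sqrtEE_cont a)
  have hd : Continuous (fun x => ((deriv ψ x : ℝ) : ℂ)) :=
    Complex.continuous_ofReal.comp hψ'.continuous
  have K1 : IntervalIntegrable (fun x => ((deriv ψ x : ℝ) : ℂ) * (((Real.sqrt x) : ℂ) * EE a x)) volume 1 2 := by
    apply ContinuousOn.intervalIntegrable
    rw [h12]
    exact hd.continuousOn.mul (sqrtEE_cont a)
  have K2 : IntervalIntegrable (fun x => ((deriv ψ x : ℝ) : ℂ) * VV a x) volume 1 2 := by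
    apply ContinuousOn.intervalIntegrable
    rw [h12]
    exact hd.continuousOn.mul (VV_cont a ha0)
  have K3 : IntervalIntegrable (fun x => ((deriv ψ x : ℝ) : ℂ) * MM a) volume 1 2 :=
    (hd.mul continuous_const).intervalIntegrable _ _
  have hFT : ∫ x in (1:ℝ)..2, ((deriv ψ x : ℝ) : ℂ) = -1 := by
    rw [intervalIntegral.integral_ofReal, intervalIntegral.integral_deriv_eq_sub
      (fun x _ => (hψ1'.differentiable (by norm_num)) x) (hψ'.continuous.intervalIntegrable _ _),
      hψ2, hone]
    simp
  have hRR : ∫ x in (1:ℝ)..2, ((deriv ψ x : ℝ) : ℂ) * RR a x =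
      (∫ x in (1:ℝ)..2, ((deriv ψ x : ℝ) : ℂ) * VV a x) + MM a
      + (∫ x in (1:ℝ)..2, ((deriv ψ x : ℝ) : ℂ) * (((Real.sqrt x) : ℂ) * EE a x)) / (Complex.I * (a:ℂ)^2) := by
    have e : ∀ x : ℝ, ((deriv ψ x : ℝ) : ℂ) * RR a x = ((deriv ψ x : ℝ) : ℂ) * VV a x
      - ((deriv ψ x : ℝ) : ℂ) * MM a
      + ((deriv ψ x : ℝ) : ℂ) * (((Real.sqrt x) : ℂ) * EE a x) / (Complex.I * (a:ℂ)^2) := by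
      intro x
      simp only [RR]
      ring
    simp_rw [e]
    rw [intervalIntegral.integral_add (K2.sub K3) (K1.div_const _),
      intervalIntegral.integral_sub K2 K3, intervalIntegral.integral_div,
      intervalIntegral.integral_mul_const, hFT]
    ring
  have tot : (∫ x in (0:ℝ)..2, (ψ x : ℂ) * (((Real.sqrt x) : ℂ) * EE a x)) - MM a =
      -(∫ x in (1:ℝ)..2, ((deriv ψ x : ℝ) : ℂ) * RR a x) +
      (∫ x in (1:ℝ)..2, ((deriv ψ x : ℝ) : ℂ) * (((Real.sqrt x) : ℂ) * EE a x)) / (Complex.I * (a:ℂ)^2) := by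
    rw [← intervalIntegral.integral_add_adjacent_intervals I1 I2, J1, parts a ha0 ψ hψ1', hψ2, hone,
      hRR]
    push_cast
    ring
  have B1 : ‖∫ x in (1:ℝ)..2, ((deriv ψ x : ℝ) : ℂ) * RR a x‖ ≤ C1 * (6 / a^3) := by
    have := intervalIntegral.norm_integral_le_of_norm_le_const (a := (1:ℝ)) (b := 2)
      (f := fun x => ((deriv ψ x : ℝ) : ℂ) * RR a x) (C := C1 * (6 / a^3)) (by
        intro x hx
        rw [Set.uIoc_of_le (by norm_num)] at hx
        rw [norm_mul, Complex.norm_real]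
        exact mul_le_mul (hC1b x ⟨hx.1.le, hx.2⟩) (RR_bound a x ha hx.1.le) (norm_nonneg _) hC1)
    refine this.trans (le_of_eq ?_)
    norm_num
  have B2 : ‖∫ x in (1:ℝ)..2, ((deriv (deriv ψ) x : ℝ) : ℂ) * VV a x‖ ≤ C2 * (7 / a^2) := by
    have := intervalIntegral.norm_integral_le_of_norm_le_const (a := (1:ℝ)) (b := 2)
      (f := fun x => ((deriv (deriv ψ) x : ℝ) : ℂ) * VV a x) (C := C2 * (7 / a^2)) (by
        intro x hx
        rw [Set.uIoc_of_le (by norm_num)] at hx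
        rw [norm_mul, Complex.norm_real]
        exact mul_le_mul (hC2b x ⟨hx.1.le, hx.2⟩) (VV_bound a x ha hx.1.le hx.2)
          (norm_nonneg _) hC2)
    refine this.trans (le_of_eq ?_)
    norm_num
  have B3 : ‖∫ x in (1:ℝ)..2, ((deriv ψ x : ℝ) : ℂ) * (((Real.sqrt x) : ℂ) * EE a x)‖
      ≤ (14 * C1 + 7 * C2) / a^2 := by
    rw [parts a ha0 (deriv ψ) hψ']
    refine (norm_sub_le _ _).trans ((add_le_add_left (norm_sub_le _ _) _).trans ?_)
    rw [norm_mul, norm_mul, Complex.norm_real, Complex.norm_real]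
    have m1 := mul_le_mul (hC1b 1 (by norm_num)) (VV_bound a 1 ha le_rfl (by norm_num))
      (norm_nonneg _) hC1
    have m2 := mul_le_mul (hC1b 2 (by norm_num)) (VV_bound a 2 ha (by norm_num) le_rfl)
      (norm_nonneg _) hC1
    refine (add_le_add (add_le_add m2 m1) B2).trans (le_of_eq ?_)
    ring
  rw [tot]
  refine (norm_add_le _ _).trans ?_
  rw [norm_neg, norm_div]
  have n1 : ‖Complex.I * (a:ℂ)^2‖ = a^2 := by simp
  rw [n1]
  have B4 : ‖∫ x in (1:ℝ)..2, ((deriv ψ x : ℝ) : ℂ) * (((Real.sqrt x) : ℂ) * EE a x)‖ / a^2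
      ≤ (14 * C1 + 7 * C2) / a^3 := by
    calc _ ≤ (14 * C1 + 7 * C2) / a^2 / a^2 := by gcongr
      _ = (14 * C1 + 7 * C2) / a^4 := by field_simp
      _ ≤ _ := by
        gcongr
        · linarith
        · norm_num
  refine (add_le_add B1 B4).trans (le_of_eq ?_)
  ring

/-- Lemma 4.4: for `κ(x) = 1_{(0,∞)}(x) ψ(x) (Real.sqrt x) e^{-i/x}` with
`ψ ∈ C_c^∞(ℝ)`, `ψ ≡ 1` on `[-1,1]`, `supp ψ ⊆ [-2,2]`, the Fourier transform satisfies
`κ̂(ξ) = √π e^{-i(2√ξ + π/4)} ξ⁻¹ + O(ξ^{-3/2})` as `ξ → ∞`; in particular `κ̂ ∉ L^1(ℝ)`. -/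
theorem stmt_19 (ψ : ℝ → ℝ) (hψ : ContDiff ℝ (⊤ : ℕ∞) ψ) (hψc : HasCompactSupport ψ)
    (hψ1 : ∀ x ∈ Set.Icc (-1 : ℝ) 1, ψ x = 1)
    (hψs : tsupport ψ ⊆ Set.Icc (-2 : ℝ) 2)
    (κ : ℝ → ℂ)
    (hκ : ∀ x : ℝ, κ x =
      if 0 < x then (↑(ψ x * Real.sqrt x) : ℂ) * Complex.exp (-(Complex.I / (x : ℂ))) else 0) :
    (fun ξ : ℝ => fourierNC κ ξ -
        (↑(Real.sqrt Real.pi) : ℂ) *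
          Complex.exp (-(Complex.I * (2 * (Real.sqrt ξ : ℂ) + (Real.pi : ℂ) / 4))) *
          ((ξ : ℂ))⁻¹)
      =O[atTop] (fun ξ : ℝ => ξ ^ (-(3 : ℝ) / 2)) ∧
    ¬ Integrable (fourierNC κ) volume := by
  have hzero : ∀ x, 2 < x → ψ x = 0 := fun x hx => by
    apply image_eq_zero_of_notMem_tsupport
    intro h
    linarith [(hψs h).2]
  have hψ2 : ψ 2 = 0 := by
    have h1 : Tendsto ψ (nhdsWithin 2 (Set.Ioi 2)) (nhds (ψ 2)) :=
      (hψ.continuous.tendsto 2).mono_left nhdsWithin_le_nhds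
    have h2 : Tendsto ψ (nhdsWithin 2 (Set.Ioi 2)) (nhds 0) := by
      refine tendsto_const_nhds.congr' ?_
      filter_upwards [self_mem_nhdsWithin] with x hx using (hzero x hx).symm
    exact tendsto_nhds_unique h1 h2
  obtain ⟨C, hC⟩ := main_bound ψ hψ hψ1 hψ2
  have hF : ∀ ξ : ℝ, 0 ≤ ξ → fourierNC κ ξ =
      ∫ x in (0:ℝ)..2, (ψ x : ℂ) * (((Real.sqrt x) : ℂ) * EE ((Real.sqrt ξ)) x) := by
    intro ξ hξ
    rw [intervalIntegral.integral_of_le (by norm_num), fourierNC,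
      ← setIntegral_eq_integral_of_forall_compl_eq_zero (s := Set.Ioc 0 2)]
    · apply setIntegral_congr_fun measurableSet_Ioc
      intro x hx
      have hx0 : (x:ℂ) ≠ 0 := by exact_mod_cast hx.1.ne'
      simp only [hκ x, if_pos hx.1, EE]
      rw [← Complex.ofReal_pow, Real.sq_sqrt hξ, mul_left_comm, ← Complex.exp_add]
      push_cast
      rw [mul_assoc]
      congr 3
      ring
    · intro x hx
      rw [hκ x]
      split_ifs with h
      · rw [hzero x (by by_contra h2; exact hx ⟨h, not_lt.mp h2⟩)]
        simp
      · simp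
  have hM : ∀ ξ : ℝ, 0 ≤ ξ → MM ((Real.sqrt ξ)) = (↑(Real.sqrt Real.pi) : ℂ) *
          Complex.exp (-(Complex.I * (2 * (Real.sqrt ξ : ℂ) + (Real.pi : ℂ) / 4))) *
          ((ξ : ℂ))⁻¹ := by
    intro ξ hξ
    rw [MM, cF, ← Complex.ofReal_pow, Real.sq_sqrt hξ, mul_add, neg_add, Complex.exp_add]
    ring
  have hO : (fun ξ : ℝ => fourierNC κ ξ -
        (↑(Real.sqrt Real.pi) : ℂ) *
          Complex.exp (-(Complex.I * (2 * (Real.sqrt ξ : ℂ) + (Real.pi : ℂ) / 4))) *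
          ((ξ : ℂ))⁻¹)
      =O[atTop] (fun ξ : ℝ => ξ ^ (-(3 : ℝ) / 2)) := by
    refine IsBigO.of_bound C ?_
    filter_upwards [eventually_ge_atTop 4] with ξ hξ
    have hξ0 : 0 ≤ ξ := by linarith
    rw [hF ξ hξ0, ← hM ξ hξ0]
    have h2 : 2 ≤ (Real.sqrt ξ) := Real.le_sqrt_of_sq_le (by linarith)
    refine (hC _ h2).trans (le_of_eq ?_)
    rw [Real.norm_of_nonneg (by positivity), div_eq_mul_inv]
    congr 1
    rw [Real.sqrt_eq_rpow, ← Real.rpow_natCast, ← Real.rpow_mul hξ0, ← Real.rpow_neg hξ0]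
    norm_num
  refine ⟨hO, fun hint => ?_⟩
  have hlo : (fun ξ : ℝ => ξ ^ (-(3 : ℝ) / 2)) =o[atTop] (fun ξ : ℝ => ξ⁻¹) := by
    have ht := tendsto_rpow_neg_atTop (show (0:ℝ) < 1 / 2 by norm_num)
    refine (isLittleO_iff_tendsto' ?_).mpr (ht.congr' ?_)
    · filter_upwards [eventually_gt_atTop 0] with x hx h
      exact absurd h (inv_pos.mpr hx).ne'
    · filter_upwards [eventually_gt_atTop 0] with x hx
      rw [div_inv_eq_mul]
      nth_rewrite 3 [← Real.rpow_one x]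
      rw [← Real.rpow_add hx]
      norm_num
  have hb := (hO.trans_isLittleO hlo).bound (c := 1/2) (by norm_num)
  obtain ⟨N, hN⟩ := eventually_atTop.mp hb
  have hI : IntegrableOn (fun x : ℝ => x⁻¹) (Set.Ioi (max N 1)) := by
    refine (hint.norm.integrableOn.const_mul 2).mono' measurable_inv.aestronglyMeasurable ?_
    refine (ae_restrict_iff' measurableSet_Ioi).mpr (Filter.Eventually.of_forall fun ξ hξ => ?_)
    have hξN : N < ξ := (le_max_left _ _).trans_lt hξ
    have hξ1 : 1 < ξ := (le_max_right _ _).trans_lt hξ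
    have hξ0 : 0 < ξ := by linarith
    have h := hN ξ hξN.le
    have hnm : ‖(↑(Real.sqrt Real.pi) : ℂ) *
          Complex.exp (-(Complex.I * (2 * (Real.sqrt ξ : ℂ) + (Real.pi : ℂ) / 4))) *
          ((ξ : ℂ))⁻¹‖ = Real.sqrt Real.pi * ξ⁻¹ := by
      have : (-(Complex.I * (2 * (Real.sqrt ξ : ℂ) + (Real.pi : ℂ) / 4))) =
        ((-(2 * (Real.sqrt ξ) + Real.pi / 4) : ℝ) : ℂ) * Complex.I := by push_cast; ring
      rw [norm_mul, norm_mul, this, Complex.norm_exp_ofReal_mul_I, norm_inv, Complex.norm_real,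
        Complex.norm_real, Real.norm_of_nonneg (Real.sqrt_nonneg _), Real.norm_of_nonneg hξ0.le,
        mul_one]
    have hpi : 1 ≤ Real.sqrt Real.pi := Real.one_le_sqrt.mpr (by linarith [Real.pi_gt_three])
    have hinv : 0 < ξ⁻¹ := inv_pos.mpr hξ0
    rw [Real.norm_of_nonneg hinv.le] at h ⊢
    have h3 := norm_sub_norm_le ((↑(Real.sqrt Real.pi) : ℂ) *
          Complex.exp (-(Complex.I * (2 * (Real.sqrt ξ : ℂ) + (Real.pi : ℂ) / 4))) *
          ((ξ : ℂ))⁻¹) (fourierNC κ ξ)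
    rw [norm_sub_rev, hnm] at h3
    nlinarith
  exact not_integrableOn_Ioi_inv hI
end
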